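/- arXiv:2506.21493 — 7 statements merged into one kernel-verified Lean document; each statement's English description precedes it below -/
import Mathlib

section
/- Let d ≥ 2 be a power of 2, let M be a finite set of items, and let (A_1, …, A_n) be a d-multi-allocation of M to n agents. Suppose every agent i has a valuation v_i on M (normalized, monotone, subadditive), and let δ_i = max_{e ∈ A_i} v_i({e}) (with δ_i = 0 if A_i is empty). Then there exists an allocation (A'_1, …, A'_n) with A'_i ⊆ A_i for every i such that v_i(A'_i) ≥ v_i(A_i)/d − ((d−1)/d)·δ_i for every agent i. -/
open Finset

/-- A valuation on `M`: normalized, monotone, and subadditive. -/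
def IsValuation {α : Type*} [DecidableEq α] (M : Finset α) (v : Finset α → ℝ) : Prop :=
  v ∅ = 0 ∧ (∀ S T : Finset α, S ⊆ T → T ⊆ M → v S ≤ v T) ∧
    ∀ S T : Finset α, S ⊆ M → T ⊆ M → v (S ∪ T) ≤ v S + v T

/-- `max_{e ∈ A} v {e}`, with value `0` if `A` is empty. -/
noncomputable def maxSingle {α : Type*} [DecidableEq α] (v : Finset α → ℝ) (A : Finset α) : ℝ :=
  if h : A.Nonempty then A.sup' h (fun e => v {e}) else 0

theorem exists_injOn_lt_card {β : Type*} [DecidableEq β] (s : Finset β) :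
    ∃ r : β → ℕ, (∀ x ∈ s, ∀ y ∈ s, r x = r y → x = y) ∧ ∀ x ∈ s, r x < s.card := by
  refine ⟨fun x => if h : x ∈ s then (s.equivFin ⟨x, h⟩ : ℕ) else 0, ?_, ?_⟩
  · intro x hx y hy hxy
    simp only [hx, hy, dif_pos] at hxy
    simpa using s.equivFin.injective (Fin.ext hxy)
  · intro x hx
    simp only [hx, dif_pos]
    exact Fin.is_lt _

/-- Agent `i` with height `p i` outbids agent `j` on an item of index `a`: heights are counted in
rounds of length `m`, shifted by `a`, and ties go to the smaller agent. -/
def Outbids {n : ℕ} (m : ℕ) (p : Fin n → ℕ) (a : ℕ) (i j : Fin n) : Prop :=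
  (p j + a) / m < (p i + a) / m ∨ ((p j + a) / m = (p i + a) / m ∧ i < j)

theorem Outbids.asymm {n m a : ℕ} {p : Fin n → ℕ} {i j : Fin n} (h : Outbids m p a i j) :
    ¬ Outbids m p a j i := by
  unfold Outbids at *
  omega

theorem Outbids.total {n : ℕ} (m a : ℕ) (p : Fin n → ℕ) {i j : Fin n} (h : i ≠ j) :
    Outbids m p a i j ∨ Outbids m p a j i := by
  unfold Outbids
  omega

theorem Outbids.mono {n m a : ℕ} {p q : Fin n → ℕ} {i j : Fin n} (h : Outbids m p a i j)
    (hi : p i ≤ q i) (hj : q j ≤ p j) : Outbids m q a i j := by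
  have h1 : (p i + a) / m ≤ (q i + a) / m := Nat.div_le_div_right (by omega)
  have h2 : (q j + a) / m ≤ (p j + a) / m := Nat.div_le_div_right (by omega)
  unfold Outbids at *
  omega

open Classical in
/-- The items of `A i` on which agent `i` outbids every rival in `V`. -/
noncomputable def won {α : Type*} {n : ℕ} (A : Fin n → Finset α) (C : α → Fin n → Fin n → Prop)
    (idx : α → ℕ) (m : ℕ) (V : Finset (Fin n)) (p : Fin n → ℕ) (i : Fin n) : Finset α :=
  (A i).filter fun e => ∀ j ∈ V, C e i j → Outbids m p (idx e) i j

section won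

variable {α : Type*} {n : ℕ} {A : Fin n → Finset α} {C : α → Fin n → Fin n → Prop}
  {idx : α → ℕ} {m : ℕ} {V : Finset (Fin n)}

theorem mem_won {p : Fin n → ℕ} {i : Fin n} {e : α} :
    e ∈ won A C idx m V p i ↔ e ∈ A i ∧ ∀ j ∈ V, C e i j → Outbids m p (idx e) i j := by
  simp [won]

theorem won_subset (p : Fin n → ℕ) (i : Fin n) : won A C idx m V p i ⊆ A i :=
  fun _ he => (mem_won.1 he).1

theorem won_mono (hirr : ∀ e i, ¬ C e i i) {p q : Fin n → ℕ} {i : Fin n} (hi : p i ≤ q i)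
    (hj : ∀ j, j ≠ i → q j ≤ p j) : won A C idx m V p i ⊆ won A C idx m V q i := by
  intro e he
  rw [mem_won] at he ⊢
  refine ⟨he.1, fun j hjV hC => (he.2 j hjV hC).mono hi (hj j ?_)⟩
  rintro rfl
  exact hirr e j hC

/-- Lowering the height of an agent by one loses her at most one item. -/
theorem card_won_sdiff_le_one (hirr : ∀ e i, ¬ C e i i) {p : Fin n → ℕ} {i : Fin n}
    (hinj : ∀ x ∈ A i, ∀ y ∈ A i, idx x = idx y → x = y) (hlt : ∀ x ∈ A i, idx x < m)
    [DecidableEq α] :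
    (won A C idx m V p i \ won A C idx m V (Function.update p i (p i - 1)) i).card ≤ 1 := by
  have key : ∀ e ∈ won A C idx m V p i \ won A C idx m V (Function.update p i (p i - 1)) i,
      e ∈ A i ∧ m ∣ p i + idx e ∧ 0 < p i := by
    intro e he
    rw [mem_sdiff, mem_won, mem_won] at he
    obtain ⟨⟨heA, h1⟩, h2⟩ := he
    refine ⟨heA, ?_⟩
    by_contra hcon
    refine h2 ⟨heA, fun j hjV hC => ?_⟩
    have hji : j ≠ i := by
      rintro rfl
      exact hirr e j hC
    have h3 := h1 j hjV hC
    have h4 : (p i - 1 + idx e) / m = (p i + idx e) / m := by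
      rcases Nat.eq_zero_or_pos (p i) with h0 | h0
      · simp [h0]
      · have hnd : ¬ m ∣ (p i - 1 + idx e) + 1 := by
          intro hd
          apply hcon
          rw [show p i - 1 + idx e + 1 = p i + idx e by omega] at hd
          exact ⟨hd, h0⟩
        have := Nat.succ_div_of_not_dvd hnd
        rw [show p i - 1 + idx e + 1 = p i + idx e by omega] at this
        exact this.symm
    simpa [Outbids, Function.update_of_ne hji, h4] using h3
  rw [card_le_one]
  intro x hx y hy
  obtain ⟨hxA, hxd, -⟩ := key x hx
  obtain ⟨hyA, hyd, -⟩ := key y hy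
  apply hinj x hxA y hyA
  have h : p i + idx x ≡ p i + idx y [MOD m] :=
    ((Nat.modEq_zero_iff_dvd).2 hxd).trans ((Nat.modEq_zero_iff_dvd).2 hyd).symm
  exact Nat.ModEq.eq_of_lt_of_lt (Nat.ModEq.add_left_cancel' _ h) (hlt x hxA) (hlt y hyA)

end won

/-- If some agent has height `0`, one of the first `n` blocks of `m` heights is unoccupied. -/
theorem exists_height_gap {n : ℕ} (m : ℕ) (p : Fin n → ℕ) {z : Fin n} (hz : p z = 0) :
    ∃ k < n, ∀ i, p i ≤ k * m ∨ (k + 1) * m < p i := by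
  by_contra! hcon
  have : Nonempty (Fin n) := ⟨z⟩
  choose! f hf using hcon
  have hinj : Function.Injective fun k : Fin n => f k := by
    intro k l hkl
    have hkl' : f k = f l := hkl
    have hk := hf k k.2
    have hl := hf l l.2
    rw [hkl'] at hk
    rcases lt_trichotomy (k : ℕ) l with h | h | h
    · have := Nat.mul_le_mul_right m (Nat.succ_le_of_lt h)
      simp only [Nat.succ_eq_add_one] at this
      omega
    · exact Fin.ext h
    · have := Nat.mul_le_mul_right m (Nat.succ_le_of_lt h)
      simp only [Nat.succ_eq_add_one] at this
      omega
  obtain ⟨k, hk⟩ := (Finite.injective_iff_surjective.1 hinj) z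
  have := (hf k k.2).1
  simp only at hk
  rw [hk, hz] at this
  omega

/-- There is a height vector at which every agent of positive height would be unsatisfied one step
lower, while every agent below the cap `B` is satisfied. -/
theorem exists_stable_heights {α : Type*} {n : ℕ} (A : Fin n → Finset α)
    (C : α → Fin n → Fin n → Prop) (hirr : ∀ e i, ¬ C e i i)
    (F : Fin n → Finset α → Prop)
    (hF : ∀ i S T, S ⊆ T → T ⊆ A i → F i S → F i T)
    (idx : α → ℕ) (m : ℕ) (V : Finset (Fin n)) (B : ℕ) :
    ∃ p : Fin n → ℕ,
      (∀ i ∈ V, 0 < p i → ¬ F i (won A C idx m V (Function.update p i (p i - 1)) i)) ∧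
      ∀ i ∈ V, p i < B → F i (won A C idx m V p i) := by
  classical
  let X : Finset (Fin n → ℕ) := (Fintype.piFinset fun _ => range (B + 1)).filter fun p =>
    ∀ i ∈ V, 0 < p i → ¬ F i (won A C idx m V (Function.update p i (p i - 1)) i)
  have hmem : ∀ p, p ∈ X ↔ (∀ i, p i ≤ B) ∧
      ∀ i ∈ V, 0 < p i → ¬ F i (won A C idx m V (Function.update p i (p i - 1)) i) := by
    intro p
    simp [X]
  have hne : X.Nonempty := ⟨0, by rw [hmem]; simp⟩
  obtain ⟨p, hpX, hmax⟩ := exists_max_image X (fun p => ∑ i, p i) hne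
  obtain ⟨hpB, hp⟩ := (hmem p).1 hpX
  refine ⟨p, hp, fun i hi hiB => ?_⟩
  by_contra hun
  have hq : Function.update p i (p i + 1) ∈ X := by
    rw [hmem]
    constructor
    · intro j
      rcases eq_or_ne j i with rfl | hj
      · simpa using hiB
      · simpa [Function.update_of_ne hj] using hpB j
    · intro j hj hpos
      rcases eq_or_ne j i with rfl | hji
      · simpa using hun
      · rw [Function.update_of_ne hji] at hpos ⊢
        intro hFj
        refine hp j hj hpos (hF j _ _ (won_mono hirr ?_ ?_) (won_subset _ _) hFj)
        · simp
        · intro k hk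
          rw [Function.update_of_ne hk, Function.update_of_ne hk]
          rcases eq_or_ne k i with rfl | hki
          · simp
          · simp [Function.update_of_ne hki]
  have h1 := hmax _ hq
  have h2 : ∑ j, p j < ∑ j, Function.update p i (p i + 1) j := by
    apply sum_lt_sum
    · intro j _
      rcases eq_or_ne j i with rfl | hj
      · simp
      · simp [Function.update_of_ne hj]
    · exact ⟨i, mem_univ _, by simp⟩
  exact absurd h2 (not_lt.2 h1)

/-- Conflicts over items, where every agent has at most one rival per item, can be resolved so that
every agent is satisfied, provided that of two sets of items covering all but one item of `A i`
at least one satisfies agent `i`. -/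
theorem exists_satisfying_resolution {α : Type*} [DecidableEq α] {n : ℕ} (M : Finset α)
    (A : Fin n → Finset α) (hAM : ∀ i, A i ⊆ M)
    (C : α → Fin n → Fin n → Prop) (hirr : ∀ e i, ¬ C e i i)
    (hsymm : ∀ e i j, C e i j → C e j i)
    (huniq : ∀ e i j k, C e i j → C e i k → j = k)
    (F : Fin n → Finset α → Prop)
    (hF : ∀ i S T, S ⊆ T → T ⊆ A i → F i S → F i T)
    (hcover : ∀ i S T, S ⊆ A i → T ⊆ A i → (A i \ (S ∪ T)).card ≤ 1 → F i S ∨ F i T)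
    (V : Finset (Fin n)) :
    ∃ B : Fin n → Finset α, (∀ i ∈ V, B i ⊆ A i ∧ F i (B i)) ∧
      ∀ i ∈ V, ∀ j ∈ V, ∀ e, C e i j → e ∈ B i → e ∉ B j := by
  obtain ⟨idx, hinj, hlt⟩ := exists_injOn_lt_card M
  set m := M.card with hm
  induction V using Finset.strongInduction with
  | H V ih =>
  obtain ⟨p, hp, hsat⟩ := exists_stable_heights A C hirr F hF idx m V (n * m + 1)
  by_cases hz : ∀ i ∈ V, 0 < p i
  · refine ⟨fun i => A i \ won A C idx m V p i, fun i hi => ⟨sdiff_subset, ?_⟩, ?_⟩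
    · refine (hcover i _ _ (won_subset _ _) sdiff_subset ?_).resolve_left (hp i hi (hz i hi))
      refine (card_le_card ?_).trans (card_won_sdiff_le_one (C := C) (idx := idx) (m := m)
        (V := V) (p := p) hirr
        (fun x hx y hy => hinj x (hAM i hx) y (hAM i hy)) fun x hx => hlt x (hAM i hx))
      intro e he
      simp only [mem_sdiff, mem_union, not_or, not_and, not_not] at he ⊢
      exact ⟨he.2.2 he.1, he.2.1⟩
    · intro i hi j hj e hC hei hej
      simp only [mem_sdiff, mem_won, not_and, not_forall] at hei hej
      obtain ⟨k, -, hk, hik⟩ := hei.2 hei.1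
      obtain ⟨l, -, hl, hjl⟩ := hej.2 hej.1
      obtain rfl := huniq e i j k hC hk
      obtain rfl := huniq e j i l (hsymm e i j hC) hl
      have hne : i ≠ j := by
        rintro rfl
        exact hirr e i hC
      exact (Outbids.total m (idx e) p hne).elim hik hjl
  · push Not at hz
    obtain ⟨z, hzV, hz0⟩ := hz
    obtain ⟨k, hkn, hgap⟩ := exists_height_gap m p (Nat.le_zero.1 hz0)
    obtain ⟨B, hB, hBC⟩ := ih (V.filter fun i => ¬ p i ≤ k * m) (by
      rw [filter_ssubset]
      exact ⟨z, hzV, by simp; omega⟩)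
    have hlow : ∀ i ∈ V, ∀ j ∈ V, ∀ e, C e i j → p i ≤ k * m → e ∈ won A C idx m V p i →
        p j ≤ k * m := by
      intro i hi j hj e hC hpi he
      have hM := hlt e (hAM i (mem_won.1 he).1)
      refine (hgap j).resolve_right fun hpj => ?_
      have h1 := (mem_won.1 he).2 j hj hC
      have h2 : (p i + idx e) / m + 1 ≤ (p j + idx e) / m := by
        rw [← Nat.add_div_right _ (by omega)]
        apply Nat.div_le_div_right
        rw [Nat.succ_mul] at hpj
        omega
      unfold Outbids at h1
      omega
    refine ⟨fun i => if p i ≤ k * m then won A C idx m V p i else B i, ?_, ?_⟩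
    · intro i hi
      by_cases hpi : p i ≤ k * m
      · simp only [hpi, if_true]
        refine ⟨won_subset _ _, hsat i hi ?_⟩
        have := Nat.mul_le_mul_right m hkn.le
        omega
      · simpa only [hpi, if_false] using hB i (mem_filter.2 ⟨hi, hpi⟩)
    · intro i hi j hj e hC
      by_cases hpi : p i ≤ k * m <;> by_cases hpj : p j ≤ k * m <;>
        simp only [hpi, hpj, if_true, if_false]
      · intro hei hej
        exact ((mem_won.1 hei).2 j hj hC).asymm ((mem_won.1 hej).2 i hi (hsymm e i j hC))
      · exact fun hei => absurd (hlow i hi j hj e hC hpi hei) hpj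
      · exact fun _ hej => hpi (hlow j hj i hi e (hsymm e i j hC) hpj hej)
      · exact hBC i (mem_filter.2 ⟨hi, hpi⟩) j (mem_filter.2 ⟨hj, hpj⟩) e hC

/-- The multiplicity of a multi-allocation can be halved. -/
theorem exists_halving {α : Type*} [DecidableEq α] (c n : ℕ) (M : Finset α)
    (A : Fin n → Finset α) (hAM : ∀ i, A i ⊆ M)
    (hmulti : ∀ e ∈ M, (univ.filter fun i => e ∈ A i).card ≤ 2 * c)
    (v : Fin n → Finset α → ℝ) (hv : ∀ i, IsValuation M (v i))
    (δ : Fin n → ℝ) (hδ0 : ∀ i, 0 ≤ δ i) (hδ : ∀ i, ∀ e ∈ A i, v i {e} ≤ δ i) :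
    ∃ A' : Fin n → Finset α, (∀ i, A' i ⊆ A i) ∧
      (∀ e ∈ M, (univ.filter fun i => e ∈ A' i).card ≤ c) ∧
      ∀ i, (v i (A i) - δ i) / 2 ≤ v i (A' i) := by
  choose r hr hrlt using fun e => exists_injOn_lt_card (univ.filter fun i => e ∈ A i)
  simp only [mem_filter, mem_univ, true_and] at hr hrlt
  obtain ⟨B, hB, hBC⟩ := exists_satisfying_resolution M A hAM
    (fun e i j => i ≠ j ∧ e ∈ A i ∧ e ∈ A j ∧ r e i / 2 = r e j / 2)
    (by simp) (fun e i j h => ⟨h.1.symm, h.2.2.1, h.2.1, h.2.2.2.symm⟩)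
    (by
      rintro e i j k ⟨hij, hi, hj, h1⟩ ⟨hik, -, hk, h2⟩
      have h3 : r e i ≠ r e j := fun h => hij (hr e i hi j hj h)
      have h4 : r e i ≠ r e k := fun h => hik (hr e i hi k hk h)
      exact hr e j hj k hk (by omega))
    (fun i S => (v i (A i) - δ i) / 2 ≤ v i S)
    (fun i S T hST hT h => h.trans ((hv i).2.1 S T hST (hT.trans (hAM i))))
    (by
      intro i S T hS hT hcard
      obtain ⟨h0, -, hsub⟩ := hv i
      have hrest : v i (A i \ (S ∪ T)) ≤ δ i := by
        rcases Nat.le_one_iff_eq_zero_or_eq_one.1 hcard with h | h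
        · rw [card_eq_zero.1 h, h0]
          exact hδ0 i
        · obtain ⟨e, he⟩ := card_eq_one.1 h
          rw [he]
          refine hδ i e (sdiff_subset (s := A i) (t := S ∪ T) ?_)
          rw [he]
          exact mem_singleton_self e
      have h1 := hsub S T (hS.trans (hAM i)) (hT.trans (hAM i))
      have h2 := hsub (S ∪ T) (A i \ (S ∪ T)) ((union_subset hS hT).trans (hAM i))
        (sdiff_subset.trans (hAM i))
      rw [union_sdiff_of_subset (union_subset hS hT)] at h2
      by_contra! hcon
      linarith [hcon.1, hcon.2])
    univ
  refine ⟨B, fun i => (hB i (mem_univ i)).1, fun e he => ?_, fun i => (hB i (mem_univ i)).2⟩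
  rw [← card_range c]
  refine card_le_card_of_injOn (fun i => r e i / 2) ?_ ?_
  · intro i hi
    simp only [coe_filter, mem_univ, true_and, Set.mem_ofPred_eq] at hi
    have h1 := hrlt e i ((hB i (mem_univ i)).1 hi)
    have h2 := hmulti e he
    simp only [coe_range, Set.mem_Iio]
    omega
  · intro i hi j hj hij
    simp only [coe_filter, mem_univ, true_and, Set.mem_ofPred_eq] at hi hj
    by_contra hne
    exact hBC i (mem_univ i) j (mem_univ j) e
      ⟨hne, (hB i (mem_univ i)).1 hi, (hB j (mem_univ j)).1 hj, hij⟩ hi hj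

theorem exists_disjoint_of_multiplicity_two_pow {α : Type*} [DecidableEq α] (n : ℕ) (M : Finset α)
    (v : Fin n → Finset α → ℝ) (hv : ∀ i, IsValuation M (v i))
    (δ : Fin n → ℝ) (hδ0 : ∀ i, 0 ≤ δ i) (k : ℕ)
    (A : Fin n → Finset α) (hAM : ∀ i, A i ⊆ M)
    (hmulti : ∀ e ∈ M, (univ.filter fun i => e ∈ A i).card ≤ 2 ^ k)
    (hδ : ∀ i, ∀ e ∈ A i, v i {e} ≤ δ i) :
    ∃ A' : Fin n → Finset α, (∀ i, A' i ⊆ A i) ∧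
      (∀ i j, i ≠ j → Disjoint (A' i) (A' j)) ∧
      ∀ i, v i (A i) / 2 ^ k - ((2 ^ k - 1 : ℝ) / 2 ^ k) * δ i ≤ v i (A' i) := by
  induction k generalizing A with
  | zero =>
    refine ⟨A, fun i => Subset.rfl, fun i j hij => ?_, fun i => by simp⟩
    rw [disjoint_left]
    intro e hi hj
    have h := hmulti e (hAM i hi)
    rw [pow_zero, card_le_one] at h
    exact hij (h i (by simpa using hi) j (by simpa using hj))
  | succ k ih =>
    obtain ⟨B, hBA, hBm, hB⟩ := exists_halving (2 ^ k) n M A hAM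
      (fun e he => (hmulti e he).trans (by rw [pow_succ, mul_comm])) v hv δ hδ0 hδ
    obtain ⟨A', hA'B, hdisj, hA'⟩ := ih B (fun i => (hBA i).trans (hAM i)) hBm
      fun i e he => hδ i e (hBA i he)
    refine ⟨A', fun i => (hA'B i).trans (hBA i), hdisj, fun i => le_trans ?_ (hA' i)⟩
    have hpos : (0 : ℝ) < 2 ^ k := by positivity
    have h := div_le_div_of_nonneg_right (hB i) hpos.le
    have heq : v i (A i) / 2 ^ (k + 1) - ((2 ^ (k + 1) - 1 : ℝ) / 2 ^ (k + 1)) * δ i =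
        (v i (A i) - δ i) / 2 / 2 ^ k - ((2 ^ k - 1 : ℝ) / 2 ^ k) * δ i := by
      rw [pow_succ]
      field_simp
      ring
    rw [heq]
    linarith

theorem le_maxSingle {α : Type*} [DecidableEq α] (v : Finset α → ℝ) {A : Finset α} {e : α}
    (he : e ∈ A) : v {e} ≤ maxSingle v A := by
  rw [maxSingle, dif_pos ⟨e, he⟩]
  exact le_sup' (fun e => v {e}) he

theorem maxSingle_nonneg {α : Type*} [DecidableEq α] {M : Finset α} {v : Finset α → ℝ}
    (hv : IsValuation M v) {A : Finset α} (hA : A ⊆ M) : 0 ≤ maxSingle v A := by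
  rcases A.eq_empty_or_nonempty with rfl | ⟨e, he⟩
  · simp [maxSingle]
  · refine le_trans ?_ (le_maxSingle v he)
    rw [← hv.1]
    exact hv.2.1 _ _ (empty_subset _) (singleton_subset_iff.2 (hA he))

theorem stmt0 {α : Type*} [DecidableEq α] (d : ℕ) (hd2 : 2 ≤ d) (hpow : ∃ k : ℕ, d = 2 ^ k)
    (n : ℕ) (M : Finset α) (A : Fin n → Finset α) (hAM : ∀ i, A i ⊆ M)
    (hmulti : ∀ e ∈ M, (Finset.univ.filter fun i => e ∈ A i).card ≤ d)
    (v : Fin n → Finset α → ℝ) (hv : ∀ i, IsValuation M (v i)) :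
    ∃ A' : Fin n → Finset α,
      (∀ i, A' i ⊆ A i) ∧
      (∀ i j, i ≠ j → Disjoint (A' i) (A' j)) ∧
      ∀ i, v i (A' i) ≥ v i (A i) / d - ((d - 1 : ℝ) / d) * maxSingle (v i) (A i) := by
  obtain ⟨k, rfl⟩ := hpow
  obtain ⟨A', hsub, hdisj, h⟩ := exists_disjoint_of_multiplicity_two_pow n M v hv
    (fun i => maxSingle (v i) (A i)) (fun i => maxSingle_nonneg (hv i) (hAM i)) k A hAM hmulti
    fun i e he => le_maxSingle (v i) he
  refine ⟨A', hsub, hdisj, fun i => ?_⟩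
  push_cast
  exact h i
end

section
/- In every multi-graph allocation instance on n agents with a finite item set M in which every agent i has a valuation v_i on M that is normalized, monotone, and subadditive and satisfies v_i(S) = v_i(S ∩ M^i) for all S ⊆ M, there exists an orientation allocation in which every agent i receives a bundle A_i with v_i(A_i) ≥ (1/2)·MMS(M, v_i, 2). -/
open Finset

/-- `MMS(M, v, k)`: the maximum, over all partitions of `M` into `k` bundles, of the
minimum value of a bundle. -/
noncomputable def MMS {α : Type*} [DecidableEq α] (M : Finset α) (v : Finset α → ℝ)
    (k : ℕ) : ℝ :=
  sSup {x : ℝ | ∃ P : Fin k → Finset α,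
    (∀ i j, i ≠ j → Disjoint (P i) (P j)) ∧
    Finset.univ.biUnion P = M ∧ x = ⨅ i : Fin k, v (P i)}

section Orientation

variable {α I : Type*}

/-- `f` gives every item having an endpoint to one of its endpoints. -/
def IsOrientation (M : Finset α) (E : α → Finset I) (f : α → I) : Prop :=
  ∀ e ∈ M, (E e).Nonempty → f e ∈ E e

lemma IsOrientation.update [DecidableEq α] {M : Finset α} {E : α → Finset I} {f : α → I}
    (hf : IsOrientation M E f) {e : α} {a : I} (ha : a ∈ E e) :
    IsOrientation M E (Function.update f e a) := by
  intro x hx hne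
  by_cases h : x = e
  · subst h; simpa using ha
  · simpa [h] using hf x hx hne

variable [DecidableEq I]

/-- The bundle of agent `i` under the allocation `f`. -/
def bundle (M : Finset α) (f : α → I) (i : I) : Finset α := M.filter fun e => f e = i

lemma mem_bundle {M : Finset α} {f : α → I} {i : I} {e : α} :
    e ∈ bundle M f i ↔ e ∈ M ∧ f e = i := by
  simp [bundle]

lemma card_bundle_lt (M : Finset α) (f : α → I) (i : I) :
    (bundle M f i).card + 1 < M.card + 2 := by
  have : (bundle M f i).card ≤ M.card := card_le_card (filter_subset _ _)
  omega

/-- The sizes of the bundles along a sequence of agents, to be compared lexicographically. -/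
def sizeProfile (M : Finset α) (N : ℕ) (f : α → I) (m : ℕ) (u : ℕ → I) :
    Lex (Fin N → Fin (M.card + 2)) :=
  toLex fun j => if (j : ℕ) < m then ⟨(bundle M f (u j)).card + 1, card_bundle_lt M f _⟩ else 0

lemma sizeProfile_lt {M : Finset α} {N m m' k : ℕ} {f f' : α → I} {u u' : ℕ → I} (hk : k < N)
    (hkm' : k < m') (hkm : k ≤ m) (hsame : ∀ i < k, bundle M f (u i) = bundle M f' (u' i))
    (hlt : k < m → (bundle M f (u k)).card < (bundle M f' (u' k)).card) :
    sizeProfile M N f m u < sizeProfile M N f' m' u' := by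
  refine ⟨⟨k, hk⟩, fun j hj => ?_, ?_⟩
  · have hjk : (j : ℕ) < k := hj
    simp [sizeProfile, hjk.trans_le hkm, hjk.trans hkm', hsame j hjk]
  · by_cases h : k < m
    · simpa [sizeProfile, h, hkm', Fin.lt_def] using hlt h
    · simp [sizeProfile, h, hkm', Fin.lt_def]

variable [DecidableEq α]

/-- An orientation in which only the agent `r` is not satisfied, with a sequence of agents
`u 0 = r, …, u (m - 1)` in which every later agent `u j` owns an item `p j` that it cannot spare
and that is shared with an earlier agent of the sequence. -/
structure IsAlternating (M : Finset α) (E : α → Finset I) (Good : I → Finset α → Prop) (r : I)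
    (f : α → I) (m : ℕ) (u : ℕ → I) (p : ℕ → α) : Prop where
  orient : IsOrientation M E f
  good : ∀ d, d ≠ r → Good d (bundle M f d)
  bad : ¬ Good r (bundle M f r)
  pos : 0 < m
  root : u 0 = r
  inj : ∀ i < m, ∀ j < m, u i = u j → i = j
  mem : ∀ j < m, 0 < j → p j ∈ bundle M f (u j)
  parent : ∀ j < m, 0 < j → ∃ i < j, u i ∈ E (p j)
  critical : ∀ j < m, 0 < j → ¬ Good (u j) ((bundle M f (u j)).erase (p j))

variable {M : Finset α} {E : α → Finset I} {Good : I → Finset α → Prop} {r : I}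
  {f : α → I} {m : ℕ} {u : ℕ → I} {p : ℕ → α}

lemma bundle_update_self {e : α} (he : e ∈ M) (a : I) :
    bundle M (Function.update f e a) a = insert e (bundle M f a) := by
  ext x
  by_cases hx : x = e
  · subst hx; simp [mem_bundle, he]
  · simp [mem_bundle, hx]

lemma bundle_update_owner {e : α} {a d : I} (hd : f e = d) (had : a ≠ d) :
    bundle M (Function.update f e a) d = (bundle M f d).erase e := by
  ext x
  by_cases hx : x = e
  · subst hx; simp [mem_bundle, had]
  · simp [mem_bundle, hx]

lemma bundle_update_of_ne {e : α} {a i : I} (hi : i ≠ f e) (hia : i ≠ a) :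
    bundle M (Function.update f e a) i = bundle M f i := by
  ext x
  by_cases hx : x = e
  · subst hx; simp [mem_bundle, hi.symm, hia.symm]
  · simp [mem_bundle, hx]

/-- Passing a spare item to the `j`-th agent of an alternating sequence either satisfies everyone
or enlarges the bundle of some agent `u k`, `k ≤ j`, without affecting its predecessors. -/
lemma IsAlternating.augment (hmono : ∀ i S T, S ⊆ T → Good i S → Good i T) (j : ℕ) :
    ∀ (f : α → I) (d : I) (e : α), IsAlternating M E Good r f (j + 1) u p →
      e ∈ bundle M f d → u j ∈ E e → Good d ((bundle M f d).erase e) → (∀ i ≤ j, u i ≠ d) →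
      (∃ f', IsOrientation M E f' ∧ ∀ i, Good i (bundle M f' i)) ∨
      ∃ k ≤ j, ∃ f', IsAlternating M E Good r f' (k + 1) u p ∧
        (∀ i < k, bundle M f' (u i) = bundle M f (u i)) ∧
        (bundle M f (u k)).card < (bundle M f' (u k)).card := by
  induction j using Nat.strong_induction_on with
  | _ j ih =>
  intro f d e hf he hue hgood hd
  obtain ⟨heM, hfe⟩ := mem_bundle.1 he
  have hjd := hd j le_rfl
  have hself := bundle_update_self (f := f) heM (u j)
  have howner := bundle_update_owner (M := M) hfe hjd
  have hother : ∀ i, i ≠ d → i ≠ u j →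
      bundle M (Function.update f e (u j)) i = bundle M f i := fun i h1 h2 =>
    bundle_update_of_ne (by rwa [hfe]) h2
  set f₁ := Function.update f e (u j)
  have hor : IsOrientation M E f₁ := hf.orient.update hue
  have hrd : r ≠ d := hf.root ▸ hd 0 (Nat.zero_le _)
  have hgood₁ : ∀ i, i ≠ r → Good i (bundle M f₁ i) := by
    intro i hi
    by_cases h1 : i = d
    · subst h1; rwa [howner]
    · by_cases h2 : i = u j
      · subst h2
        rw [hself]
        exact hmono _ _ _ (subset_insert _ _) (hf.good _ hi)
      · rw [hother i h1 h2]; exact hf.good i hi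
  have hpre : ∀ i < j, bundle M f₁ (u i) = bundle M f (u i) := fun i hi =>
    hother _ (hd i hi.le) fun h => hi.ne (hf.inj i (by omega) j (by omega) h)
  have hcard : (bundle M f (u j)).card < (bundle M f₁ (u j)).card := by
    rw [hself, card_insert_of_notMem]
    · omega
    · rw [mem_bundle]
      rintro ⟨-, h⟩
      exact hjd (h.symm.trans hfe)
  rcases Nat.eq_zero_or_pos j with rfl | hj
  · by_cases hr : Good r (bundle M f₁ r)
    · refine Or.inl ⟨f₁, hor, fun i => ?_⟩
      by_cases hi : i = r
      · exact hi ▸ hr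
      · exact hgood₁ i hi
    · exact Or.inr ⟨0, le_rfl, f₁,
        ⟨hor, hgood₁, hr, hf.pos, hf.root, hf.inj, by omega, by omega, by omega⟩,
        hpre, hcard⟩
  have hrj : r ≠ u j := fun h =>
    hj.ne (hf.inj 0 (by omega) j (by omega) (hf.root.trans h))
  have hbad : ¬ Good r (bundle M f₁ r) := by
    rw [hother r hrd hrj]; exact hf.bad
  have hmem : p j ∈ bundle M f₁ (u j) := by
    rw [hself]; exact mem_insert_of_mem (hf.mem j (by omega) hj)
  have hrestrict : ∀ k < j, IsAlternating M E Good r f₁ (k + 1) u p := fun k hk =>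
    ⟨hor, hgood₁, hbad, by omega, hf.root,
      fun a ha b hb => hf.inj a (by omega) b (by omega),
      fun a ha h0 => by rw [hpre a (by omega)]; exact hf.mem a (by omega) h0,
      fun a ha h0 => hf.parent a (by omega) h0,
      fun a ha h0 => by rw [hpre a (by omega)]; exact hf.critical a (by omega) h0⟩
  by_cases hcrit : Good (u j) ((bundle M f₁ (u j)).erase (p j))
  · obtain ⟨i, hij, hi⟩ := hf.parent j (by omega) hj
    rcases ih i hij f₁ (u j) (p j) (hrestrict i hij) hmem hi hcrit
      (fun a ha h => by have := hf.inj a (by omega) j (by omega) h; omega) with h | h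
    · exact Or.inl h
    · obtain ⟨k, hk, f', hf', hsame, hlt⟩ := h
      refine Or.inr ⟨k, by omega, f', hf', fun a ha => ?_, ?_⟩
      · rw [hsame a ha, hpre a (by omega)]
      · rwa [hpre k (by omega)] at hlt
  · refine Or.inr ⟨j, le_rfl, f₁, ⟨hor, hgood₁, hbad, hf.pos, hf.root, hf.inj, ?_, hf.parent, ?_⟩,
      hpre, hcard⟩
    · intro a ha h0
      rcases (Nat.lt_succ_iff.1 ha).lt_or_eq with h | rfl
      · rw [hpre a h]; exact hf.mem a ha h0
      · exact hmem
    · intro a ha h0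
      rcases (Nat.lt_succ_iff.1 ha).lt_or_eq with h | rfl
      · rw [hpre a h]; exact hf.critical a ha h0
      · exact hcrit

/-- If no agent outside an alternating sequence owns an item shared with an agent of the sequence,
exchanging the items inside the sequence satisfies everyone. -/
lemma IsAlternating.exchange (hE : ∀ e ∈ M, (E e).card ≤ 2)
    (hmono : ∀ i S T, S ⊆ T → Good i S → Good i T) {P Q : I → Finset α}
    (hP : ∀ i, ∀ e ∈ P i, e ∈ M ∧ i ∈ E e) (hQ : ∀ i, ∀ e ∈ Q i, e ∈ M ∧ i ∈ E e)
    (hPQ : ∀ i, Disjoint (P i) (Q i))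
    (hcompl : ∀ i S, ¬ Good i S → Good i (P i \ S) ∧ Good i (Q i \ S))
    (hf : IsAlternating M E Good r f m u p)
    (hclosed : ∀ d, (∀ i < m, u i ≠ d) → ∀ j < m, ∀ e ∈ bundle M f d, u j ∉ E e) :
    ∃ f', IsOrientation M E f' ∧ ∀ i, Good i (bundle M f' i) := by
  classical
  have hX : ∀ j, ∃ X : Finset α, (∀ e ∈ X, e ∈ M ∧ u j ∈ E e) ∧
      (j < m → Good (u j) (X \ bundle M f (u j))) := by
    intro j
    by_cases hj : j < m
    swap
    · exact ⟨∅, by simp, fun h => absurd h hj⟩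
    have hb : ¬ Good (u j) ((bundle M f (u j)).erase (p j)) := by
      rcases Nat.eq_zero_or_pos j with rfl | h0
      · exact fun h => hf.bad (by
          rw [← hf.root]; exact hmono _ _ _ (erase_subset _ _) h)
      · exact hf.critical j hj h0
    have key : ∀ X : Finset α, p j ∉ X → Good (u j) (X \ (bundle M f (u j)).erase (p j)) →
        Good (u j) (X \ bundle M f (u j)) := by
      intro X hp h
      refine hmono _ _ _ ?_ h
      intro x hx
      simp only [mem_sdiff, mem_erase, not_and] at hx ⊢
      exact ⟨hx.1, hx.2 fun h => hp (h ▸ hx.1)⟩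
    by_cases hp : p j ∈ P (u j)
    · exact ⟨Q (u j), hQ _, fun _ => key _ (disjoint_left.1 (hPQ _) hp) (hcompl _ _ hb).2⟩
    · exact ⟨P (u j), hP _, fun _ => key _ hp (hcompl _ _ hb).1⟩
  choose X hXE hXG using hX
  have huniq : ∀ i < m, ∀ j < m, ∀ e, e ∈ X i \ bundle M f (u i) →
      e ∈ X j \ bundle M f (u j) → i = j := by
    intro i hi j hj e hei hej
    by_contra hne
    rw [mem_sdiff] at hei hej
    obtain ⟨heM, hui⟩ := hXE i e hei.1
    have huj := (hXE j e hej.1).2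
    have h1 : f e ≠ u i := fun h => hei.2 (mem_bundle.2 ⟨heM, h⟩)
    have h2 : f e ≠ u j := fun h => hej.2 (mem_bundle.2 ⟨heM, h⟩)
    have h3 : u i ≠ u j := fun h => hne (hf.inj i hi j hj h)
    have hsub : ({f e, u i, u j} : Finset I) ⊆ E e := by
      intro x hx
      simp only [mem_insert, mem_singleton] at hx
      rcases hx with rfl | rfl | rfl
      · exact hf.orient e heM ⟨_, hui⟩
      · exact hui
      · exact huj
    have := card_le_card hsub
    rw [card_eq_three.2 ⟨_, _, _, h1, h2, h3, rfl⟩] at this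
    have := hE e heM
    omega
  let f' : α → I := fun e =>
    if h : ∃ j < m, e ∈ X j \ bundle M f (u j) then u h.choose else f e
  have hf'X : ∀ j < m, ∀ e ∈ X j \ bundle M f (u j), f' e = u j := by
    intro j hj e he
    have h : ∃ j < m, e ∈ X j \ bundle M f (u j) := ⟨j, hj, he⟩
    simp only [f', dif_pos h]
    rw [huniq _ h.choose_spec.1 j hj e h.choose_spec.2 he]
  have hf'n : ∀ e, (¬ ∃ j < m, e ∈ X j \ bundle M f (u j)) → f' e = f e := by
    intro e h
    simp only [f', dif_neg h]
  refine ⟨f', fun e heM hne => ?_, fun i => ?_⟩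
  · by_cases h : ∃ j < m, e ∈ X j \ bundle M f (u j)
    · obtain ⟨j, hj, he⟩ := h
      rw [hf'X j hj e he]
      exact (hXE j e (mem_sdiff.1 he).1).2
    · rw [hf'n e h]; exact hf.orient e heM hne
  · by_cases hi : ∃ j < m, u j = i
    · obtain ⟨j, hj, rfl⟩ := hi
      refine hmono _ _ _ (fun e he => ?_) (hXG j hj)
      exact mem_bundle.2 ⟨(hXE j e (mem_sdiff.1 he).1).1, hf'X j hj e he⟩
    · push Not at hi
      have hir : i ≠ r := fun h => hi 0 hf.pos (hf.root.trans h.symm)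
      refine hmono _ _ _ (fun e he => ?_) (hf.good i hir)
      refine mem_bundle.2 ⟨(mem_bundle.1 he).1, ?_⟩
      rw [hf'n e, (mem_bundle.1 he).2]
      rintro ⟨j, hj, hej⟩
      exact hclosed i hi j hj e he (hXE j e (mem_sdiff.1 hej).1).2

/-- An alternating sequence can be extended by an agent which cannot spare an item it shares with
an agent of the sequence. -/
lemma IsAlternating.extend (hf : IsAlternating M E Good r f m u p) {d : I} {e : α} {j : ℕ}
    (hd : ∀ i < m, u i ≠ d) (hj : j < m) (he : e ∈ bundle M f d) (hue : u j ∈ E e)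
    (hcrit : ¬ Good d ((bundle M f d).erase e)) :
    IsAlternating M E Good r f (m + 1) (Function.update u m d) (Function.update p m e) := by
  have hu : ∀ i < m, Function.update u m d i = u i := fun i hi =>
    Function.update_of_ne hi.ne _ _
  have hp : ∀ i < m, Function.update p m e i = p i := fun i hi =>
    Function.update_of_ne hi.ne _ _
  have hlt : ∀ {i}, i < m + 1 → i < m ∨ i = m := fun h => (Nat.lt_succ_iff.1 h).lt_or_eq
  refine ⟨hf.orient, hf.good, hf.bad, by omega, by rw [hu 0 hf.pos, hf.root], ?_, ?_, ?_, ?_⟩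
  · intro a ha b hb hab
    rcases hlt ha with h1 | rfl <;> rcases hlt hb with h2 | rfl
    · rw [hu a h1, hu b h2] at hab; exact hf.inj a h1 b h2 hab
    · rw [hu a h1, Function.update_self] at hab; exact absurd hab (hd a h1)
    · rw [hu b h2, Function.update_self] at hab; exact absurd hab.symm (hd b h2)
    · rfl
  · intro a ha h0
    rcases hlt ha with h1 | rfl
    · rw [hu a h1, hp a h1]; exact hf.mem a h1 h0
    · simpa using he
  · intro a ha h0
    rcases hlt ha with h1 | rfl
    · obtain ⟨i, hi, h⟩ := hf.parent a h1 h0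
      exact ⟨i, hi, by rwa [hu i (by omega), hp a h1]⟩
    · exact ⟨j, hj, by rwa [hu j hj, Function.update_self]⟩
  · intro a ha h0
    rcases hlt ha with h1 | rfl
    · rw [hu a h1, hp a h1]; exact hf.critical a h1 h0
    · simpa using hcrit

/-- If all agents but one can be satisfied by an orientation, then all agents can. -/
lemma exists_orientation_of_forall_ne [Fintype I] (hE : ∀ e ∈ M, (E e).card ≤ 2)
    (hmono : ∀ i S T, S ⊆ T → Good i S → Good i T) {P Q : I → Finset α}
    (hP : ∀ i, ∀ e ∈ P i, e ∈ M ∧ i ∈ E e) (hQ : ∀ i, ∀ e ∈ Q i, e ∈ M ∧ i ∈ E e)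
    (hPQ : ∀ i, Disjoint (P i) (Q i))
    (hcompl : ∀ i S, ¬ Good i S → Good i (P i \ S) ∧ Good i (Q i \ S))
    (hf : IsOrientation M E f) (hgood : ∀ d, d ≠ r → Good d (bundle M f d)) :
    ∃ f', IsOrientation M E f' ∧ ∀ i, Good i (bundle M f' i) := by
  by_contra hnone
  have hr : ¬ Good r (bundle M f r) := fun h => hnone ⟨f, hf, fun i => by
    by_cases hi : i = r
    · exact hi ▸ h
    · exact hgood i hi⟩
  have hα : Nonempty α := by
    by_contra h
    rw [not_nonempty_iff] at h
    refine hr ?_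
    have := (hcompl r _ hr).1
    rwa [Subsingleton.elim (bundle M f r) (P r \ bundle M f r)]
  obtain ⟨e₀⟩ := hα
  let S : Set (Lex (Fin (Fintype.card I) → Fin (M.card + 2))) :=
    {x | ∃ f m u p, IsAlternating M E Good r f m u p ∧ x = sizeProfile M _ f m u}
  have hS : S.Nonempty := ⟨_, f, 1, fun _ => r, fun _ => e₀,
    ⟨hf, hgood, hr, one_pos, rfl, by omega, by omega, by omega, by omega⟩, rfl⟩
  obtain ⟨x, ⟨f, m, u, p, hA, rfl⟩, hmax⟩ :=
    (wellFounded_gt (α := Lex (Fin (Fintype.card I) → Fin (M.card + 2)))).has_min S hS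
  have hcardI : ∀ {f m u p}, IsAlternating M E Good r f m u p → m ≤ Fintype.card I := by
    intro f m u p h
    have := Fintype.card_le_of_injective (fun i : Fin m => u i)
      fun a b hab => Fin.ext (h.inj a a.2 b b.2 hab)
    simpa using this
  refine hnone (hA.exchange hE hmono hP hQ hPQ hcompl fun d hd j hj e he hue => ?_)
  by_cases hcrit : Good d ((bundle M f d).erase e)
  · have hA' : IsAlternating M E Good r f (j + 1) u p :=
      ⟨hA.orient, hA.good, hA.bad, by omega, hA.root,
        fun a ha b hb => hA.inj a (by omega) b (by omega),
        fun a ha => hA.mem a (by omega), fun a ha => hA.parent a (by omega),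
        fun a ha => hA.critical a (by omega)⟩
    rcases IsAlternating.augment hmono j f d e hA' he hue hcrit
      (fun i hi => hd i (by omega)) with h | ⟨k, hk, f', hf', hsame, hlt⟩
    · exact hnone h
    · refine hmax _ ⟨f', _, u, p, hf', rfl⟩ ?_
      exact sizeProfile_lt (k := k) (by have := hcardI hA; omega) (by omega) (by omega)
        (fun i hi => (hsame i hi).symm) fun _ => hlt
  · have hA' := hA.extend hd hj he hue hcrit
    refine hmax _ ⟨f, _, _, _, hA', rfl⟩ ?_
    refine sizeProfile_lt (k := m) (by have := hcardI hA'; omega) (by omega) le_rfl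
      (fun i hi => ?_) fun h => absurd h (lt_irrefl m)
    rw [Function.update_of_ne hi.ne]

/-- If the items of each agent contain two disjoint sets such that whenever a set does not satisfy the
agent, both sets do after removing it, then some orientation satisfies every agent. -/
theorem exists_orientation_forall_good [Fintype I] [Nonempty I] (hE : ∀ e ∈ M, (E e).card ≤ 2)
    (hmono : ∀ i S T, S ⊆ T → Good i S → Good i T) {P Q : I → Finset α}
    (hP : ∀ i, ∀ e ∈ P i, e ∈ M ∧ i ∈ E e) (hQ : ∀ i, ∀ e ∈ Q i, e ∈ M ∧ i ∈ E e)
    (hPQ : ∀ i, Disjoint (P i) (Q i))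
    (hcompl : ∀ i S, ¬ Good i S → Good i (P i \ S) ∧ Good i (Q i \ S)) :
    ∃ f, IsOrientation M E f ∧ ∀ i, Good i (bundle M f i) := by
  classical
  suffices h : ∀ T : Finset I, ∃ f, IsOrientation M E f ∧ ∀ i ∈ T, Good i (bundle M f i) by
    obtain ⟨f, hf, h⟩ := h univ
    exact ⟨f, hf, fun i => h i (mem_univ i)⟩
  intro T
  induction T using Finset.induction_on with
  | empty =>
    refine ⟨fun e => if h : (E e).Nonempty then h.choose else Classical.arbitrary I, ?_, by simp⟩
    intro e _ hne
    simpa only [dif_pos hne] using hne.choose_spec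
  | insert r T _ ih =>
    obtain ⟨f, hf, hT⟩ := ih
    obtain ⟨f', hf', h⟩ := exists_orientation_of_forall_ne (r := r)
      (Good := fun i S => i ∈ insert r T → Good i S) hE
      (fun i S S' hS h hi => hmono i S S' hS (h hi)) hP hQ hPQ
      (fun i S h => by
        push Not at h
        exact ⟨fun _ => (hcompl i S h.2).1, fun _ => (hcompl i S h.2).2⟩)
      hf (fun d hd hdT => hT d (mem_of_mem_insert_of_ne hdT hd))
    exact ⟨f', hf', h⟩

end Orientation

/-- The maximin share for two bundles is attained by a partition. -/
lemma exists_partition_MMS_two {α : Type*} [DecidableEq α] (M : Finset α) (v : Finset α → ℝ) :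
    ∃ P Q : Finset α, Disjoint P Q ∧ P ⊆ M ∧ Q ⊆ M ∧ MMS M v 2 ≤ v P ∧ MMS M v 2 ≤ v Q := by
  have hfin : {x : ℝ | ∃ P : Fin 2 → Finset α, (∀ i j, i ≠ j → Disjoint (P i) (P j)) ∧
      Finset.univ.biUnion P = M ∧ x = ⨅ i : Fin 2, v (P i)}.Finite := by
    refine ((Fintype.piFinset fun _ : Fin 2 => M.powerset).finite_toSet.image
      fun P => ⨅ i : Fin 2, v (P i)).subset ?_
    rintro x ⟨P, -, hPM, rfl⟩
    refine ⟨P, ?_, rfl⟩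
    simp only [mem_coe, Fintype.mem_piFinset, mem_powerset]
    exact fun i => hPM ▸ subset_biUnion_of_mem P (mem_univ i)
  have hne : {x : ℝ | ∃ P : Fin 2 → Finset α, (∀ i j, i ≠ j → Disjoint (P i) (P j)) ∧
      Finset.univ.biUnion P = M ∧ x = ⨅ i : Fin 2, v (P i)}.Nonempty := by
    refine ⟨_, ![M, ∅], ?_, ?_, rfl⟩
    · intro i j hij
      fin_cases i <;> fin_cases j <;> simp_all
    · ext x
      simp [Fin.exists_fin_two]
  obtain ⟨P, hdisj, hPM, hx⟩ := hne.csSup_mem hfin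
  have hle : ∀ i, MMS M v 2 ≤ v (P i) := fun i =>
    hx.trans_le (ciInf_le (Set.finite_range _).bddBelow i)
  have hsub : ∀ i, P i ⊆ M := fun i => hPM ▸ subset_biUnion_of_mem P (mem_univ i)
  exact ⟨P 0, P 1, hdisj 0 1 (by decide), hsub 0, hsub 1, hle 0, hle 1⟩

theorem stmt1 {α : Type*} [DecidableEq α] (n : ℕ) (hn : 0 < n)
    (M : Finset α) (E : α → Finset (Fin n)) (hE : ∀ e ∈ M, (E e).card ≤ 2)
    (v : Fin n → Finset α → ℝ) (hv : ∀ i, IsValuation M (v i))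
    (hloc : ∀ i, ∀ S ⊆ M, v i S = v i (S.filter fun e => i ∈ E e)) :
    ∃ f : α → Fin n,
      (∀ e ∈ M, (E e).Nonempty → f e ∈ E e) ∧
      ∀ i, v i (M.filter fun e => f e = i) ≥ (1 / 2) * MMS M (v i) 2 := by
  have : Nonempty (Fin n) := ⟨⟨0, hn⟩⟩
  choose P Q hPQ hPM hQM hPv hQv using fun i => exists_partition_MMS_two M (v i)
  have hcompl : ∀ i, ∀ S X : Finset α, X ⊆ M → MMS M (v i) 2 ≤ v i X →
      ¬ (1 / 2) * MMS M (v i) 2 ≤ v i (S ∩ M) →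
      (1 / 2) * MMS M (v i) 2 ≤ v i ((X.filter (fun e => i ∈ E e) \ S) ∩ M) := by
    intro i S X hX hXv hS
    obtain ⟨-, hmono, hsub⟩ := hv i
    rw [hloc i X hX] at hXv
    set Y := X.filter fun e => i ∈ E e
    have hY : Y ⊆ M := (filter_subset _ _).trans hX
    have h1 := hsub ((Y \ S) ∩ M) (S ∩ M) inter_subset_right inter_subset_right
    have h2 : v i Y ≤ v i ((Y \ S) ∩ M ∪ S ∩ M) := by
      refine hmono _ _ (fun x hx => ?_) (union_subset inter_subset_right inter_subset_right)
      have := hY hx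
      by_cases hxS : x ∈ S <;> simp [hx, hxS, this]
    linarith
  obtain ⟨f, hf, h⟩ := exists_orientation_forall_good (M := M) (E := E)
    (Good := fun i S => (1 / 2) * MMS M (v i) 2 ≤ v i (S ∩ M))
    (P := fun i => (P i).filter fun e => i ∈ E e) (Q := fun i => (Q i).filter fun e => i ∈ E e) hE
    (fun i S T hST h => h.trans ((hv i).2.1 _ _ (inter_subset_inter_right hST) inter_subset_right))
    (fun i e he => ⟨hPM i (mem_filter.1 he).1, (mem_filter.1 he).2⟩)
    (fun i e he => ⟨hQM i (mem_filter.1 he).1, (mem_filter.1 he).2⟩)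
    (fun i => disjoint_filter_filter (hPQ i))
    (fun i S hS => ⟨hcompl i S _ (hPM i) (hPv i) hS, hcompl i S _ (hQM i) (hQv i) hS⟩)
  refine ⟨f, hf, fun i => ?_⟩
  have := h i
  rwa [inter_eq_left.2 (show bundle M f i ⊆ M from filter_subset _ _)] at this
end

section
/- Let d ≥ 2 be an integer, let ρ > 0, and let d̂ = 2^⌈log₂ d⌉ be the smallest power of 2 that is at least d. Suppose that for every finite item set M, every number of agents n, and every profile of normalized, monotone, subadditive valuations (v_1, …, v_n) on M, there exists a d-multi-allocation (A_1, …, A_n) with v_i(A_i) ≥ ρ·MMS(M, v_i, n) for every agent i. Then for every finite item set M, every n, and every such profile of valuations, there exists an allocation (A'_1, …, A'_n) with v_i(A'_i) ≥ (ρ/(2d̂−1))·MMS(M, v_i, n) for every agent i. -/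
open Finset

universe u

/-- A finite set closed under a relation contains a nonempty closed subset in which every property
preserved by the relation holds everywhere as soon as it holds somewhere. -/
theorem exists_recurrent_subset {σ : Type*} (s : Finset σ) (hs : s.Nonempty) (R : σ → σ → Prop)
    (hR : ∀ a ∈ s, ∀ b, R a b → b ∈ s) :
    ∃ C ⊆ s, C.Nonempty ∧ (∀ a ∈ C, ∀ b, R a b → b ∈ C) ∧
      ∀ Q : σ → Prop, (∃ a ∈ C, Q a) → (∀ a ∈ C, Q a → ∀ b, R a b → Q b) → ∀ a ∈ C, Q a := by
  classical
  obtain ⟨C, hC⟩ := exists_minimal_of_wellFoundedLT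
    (fun C : Finset σ => C ⊆ s ∧ C.Nonempty ∧ ∀ a ∈ C, ∀ b, R a b → b ∈ C)
    ⟨s, Subset.rfl, hs, hR⟩
  obtain ⟨hCs, hne, hcl⟩ := hC.prop
  refine ⟨C, hCs, hne, hcl, fun Q ⟨a, ha, hQa⟩ hQ b hb => ?_⟩
  have hsub : C ⊆ C.filter Q := hC.le_of_le
    ⟨(filter_subset _ _).trans hCs, ⟨a, mem_filter.2 ⟨ha, hQa⟩⟩, fun x hx y hxy => by
      rw [mem_filter] at hx ⊢
      exact ⟨hcl x hx.1 y hxy, hQ x hx.1 hx.2 y hxy⟩⟩ (filter_subset _ _)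
  exact (mem_filter.1 (hsub hb)).2

section Transfer

variable {ι α : Type*} [DecidableEq ι] [DecidableEq α]

/-- The bundles obtained from `O` when agent `u` takes the item `e` from agent `w`. -/
def transfer (O : ι → Finset α) (u w : ι) (e : α) : ι → Finset α :=
  Function.update (Function.update O w ((O w).erase e)) u (insert e (O u))

theorem transfer_taker (O : ι → Finset α) (u w : ι) (e : α) :
    transfer O u w e u = insert e (O u) := by
  simp [transfer]

theorem transfer_subset (O : ι → Finset α) {u w i : ι} (e : α) (hi : i ≠ u) :
    transfer O u w e i ⊆ O i := by
  by_cases h : i = w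
  · subst h
    simp [transfer, hi, erase_subset]
  · simp [transfer, hi, h]

theorem mem_transfer_of_ne (O : ι → Finset α) (u w i : ι) {e x : α} (hx : x ≠ e) :
    x ∈ transfer O u w e i ↔ x ∈ O i := by
  by_cases hu : i = u
  · subst hu
    simp [transfer, hx]
  · by_cases hw : i = w
    · subst hw
      simp [transfer, hu, hx]
    · simp [transfer, hu, hw]

theorem mem_transfer_self (O : ι → Finset α) (u w i : ι) (e : α) :
    e ∈ transfer O u w e i ↔ i = u ∨ i ≠ w ∧ e ∈ O i := by
  by_cases hu : i = u
  · subst hu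
    simp [transfer]
  · by_cases hw : i = w
    · subst hw
      simp [transfer, hu]
    · simp [transfer, hu, hw]

variable [Fintype ι]

theorem card_owners_transfer (O : ι → Finset α) {u w : ι} {e : α} (hu : e ∉ O u) (hw : e ∈ O w)
    (x : α) : #{i | x ∈ transfer O u w e i} = #{i | x ∈ O i} := by
  by_cases hx : x = e
  · subst hx
    have : (univ.filter fun i => x ∈ transfer O u w x i) =
        insert u ((univ.filter fun i => x ∈ O i).erase w) := by
      ext i
      simp [mem_transfer_self]
    rw [this, card_insert_of_notMem (by simp [hu]), card_erase_add_one (by simp [hw])]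
  · simp [mem_transfer_of_ne O u w _ hx]

theorem card_nonowners_transfer (A O : ι → Finset α) {u w : ι} {e : α} (hu : e ∉ O u)
    (hw : e ∈ O w) (hAu : e ∈ A u) (hAw : e ∈ A w) (x : α) :
    #{i | x ∈ A i ∧ x ∉ transfer O u w e i} = #{i | x ∈ A i ∧ x ∉ O i} := by
  by_cases hx : x = e
  · subst hx
    have hne : u ≠ w := fun h => hu (h ▸ hw)
    have : (univ.filter fun i => x ∈ A i ∧ x ∉ transfer O u w x i) =
        insert w ((univ.filter fun i => x ∈ A i ∧ x ∉ O i).erase u) := by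
      ext i
      simp only [mem_filter, mem_univ, true_and, mem_transfer_self, mem_insert, mem_erase]
      by_cases hiw : i = w
      · subst hiw
        simp [hAw, hne.symm]
      · simp only [hiw]
        tauto
    rw [this, card_insert_of_notMem (by simp [hw]), card_erase_add_one (by simp [hu, hAu])]
  · simp [mem_transfer_of_ne O u w _ hx]

/-- Every multi-allocation can be split evenly: if each item is held at most `2 * h` times, then
one can keep each item for some of its holders, so that at most `h` keep it and at most `h`
lose it. -/
theorem exists_even_split (M : Finset α) (A : ι → Finset α) (h : ℕ)
    (hm : ∀ e ∈ M, #{i | e ∈ A i} ≤ 2 * h) :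
    ∃ O : ι → Finset α, (∀ i, O i ⊆ A i) ∧
      ∀ e ∈ M, #{i | e ∈ O i} ≤ h ∧ #{i | e ∈ A i ∧ e ∉ O i} ≤ h := by
  have key : ∀ e, ∃ T : Finset ι, T ⊆ univ.filter (fun i => e ∈ A i) ∧
      T.card = min h #{i | e ∈ A i} := fun e => exists_subset_card_eq (min_le_right _ _)
  choose T hT hTc using key
  refine ⟨fun i => (A i).filter fun e => i ∈ T e, fun i => filter_subset _ _, fun e he => ?_⟩
  have h1 : (univ.filter fun i => e ∈ (A i).filter fun e => i ∈ T e) = T e := by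
    ext i
    have := @hT e i
    simp only [mem_filter, mem_univ, true_and] at this ⊢
    tauto
  have h2 : (univ.filter fun i => e ∈ A i ∧ e ∉ (A i).filter fun e => i ∈ T e) =
      (univ.filter fun i => e ∈ A i) \ T e := by
    ext i
    simp only [mem_filter, mem_univ, true_and, mem_sdiff]
    tauto
  rw [h1, h2, card_sdiff_of_subset (hT e), hTc]
  have := hm e he
  omega

/-- A multi-allocation of multiplicity `2 * h` in which every item is small can be thinned out to
one of multiplicity `h`, at the cost of half of the value of every agent, up to one item. -/
theorem exists_halved_multiallocation (M : Finset α) (v : ι → Finset α → ℝ)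
    (hv : ∀ i, IsValuation M (v i)) (t c : ι → ℝ) (ht : ∀ i, 0 ≤ t i)
    (A : ι → Finset α) (hA : ∀ i, A i ⊆ M) (h : ℕ)
    (hm : ∀ e ∈ M, #{i | e ∈ A i} ≤ 2 * h) (hs : ∀ i, ∀ e ∈ M, v i {e} ≤ t i)
    (hval : ∀ i, 2 * c i + t i ≤ v i (A i)) :
    ∃ B : ι → Finset α, (∀ i, B i ⊆ M) ∧ (∀ e ∈ M, #{i | e ∈ B i} ≤ h) ∧
      ∀ i, c i ≤ v i (B i) := by
  classical
  set s : Finset (ι → Finset α) := (Fintype.piFinset fun i => (A i).powerset).filter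
    fun O => ∀ e ∈ M, #{i | e ∈ O i} ≤ h ∧ #{i | e ∈ A i ∧ e ∉ O i} ≤ h with hsdef
  have hmem : ∀ O, O ∈ s ↔ (∀ i, O i ⊆ A i) ∧
      ∀ e ∈ M, #{i | e ∈ O i} ≤ h ∧ #{i | e ∈ A i ∧ e ∉ O i} ≤ h := by
    intro O
    simp [hsdef, Fintype.mem_piFinset]
  -- An agent worth less than `c` takes one of its items from another agent.
  let R : (ι → Finset α) → (ι → Finset α) → Prop := fun O O' =>
    ∃ u w e, v u (O u) < c u ∧ e ∈ A u ∧ e ∉ O u ∧ e ∈ O w ∧ O' = transfer O u w e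
  obtain ⟨O₀, hO₀⟩ := exists_even_split M A h hm
  obtain ⟨C, hCs, ⟨O, hO⟩, hcl, hrec⟩ := exists_recurrent_subset s ⟨O₀, (hmem _).2 hO₀⟩ R (by
    rintro O hO _ ⟨u, w, e, -, heA, heu, hew, rfl⟩
    rw [hmem] at hO ⊢
    refine ⟨fun i => ?_, fun x hx => ?_⟩
    · by_cases hi : i = u
      · subst hi
        rw [transfer_taker]
        exact insert_subset heA (hO.1 i)
      · exact (transfer_subset O e hi).trans (hO.1 i)
    · rw [card_owners_transfer O heu hew,
        card_nonowners_transfer A O heu hew heA (hO.1 w hew)]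
      exact hO.2 x hx)
  have hsub : ∀ O ∈ C, ∀ i, O i ⊆ A i := fun O hO => ((hmem O).1 (hCs hO)).1
  let I : ι → Prop := fun i => ∃ O ∈ C, v i (O i) < c i
  have hconst : ∀ w, ¬ I w → ∀ e, (∃ O ∈ C, e ∉ O w) → ∀ O ∈ C, e ∉ O w := by
    intro w hw e hex
    refine hrec (fun O => e ∉ O w) hex ?_
    rintro O hO heO _ ⟨u, w', e', hu, -, -, -, rfl⟩ hmem'
    have hwu : w ≠ u := by
      rintro rfl
      exact hw ⟨O, hO, hu⟩
    exact heO (transfer_subset O e' hwu hmem')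
  have howned : ∀ w, ¬ I w → ∀ O ∈ C, ∀ e ∈ O w, ∀ u, v u (O u) < c u → e ∈ A u → e ∈ O u := by
    intro w hw O hO e hew u hu heA
    by_contra heu
    have hO' : transfer O u w e ∈ C := hcl O hO _ ⟨u, w, e, hu, heA, heu, hew, rfl⟩
    refine hconst w hw e ⟨_, hO', ?_⟩ O hO hew
    have : w ≠ u := by
      rintro rfl
      exact heu hew
    simp [mem_transfer_self, this]
  have hkeep : ∀ w, ¬ I w → ∀ e ∈ O w, ∀ u, I u → e ∈ A u → e ∈ O u := by
    intro w hw e hew u hu heA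
    have hall : ∀ O' ∈ C, e ∈ O' w := by
      intro O' hO'
      by_contra hne
      exact hconst w hw e ⟨O', hO', hne⟩ O hO hew
    obtain ⟨O₁, hO₁, hlt⟩ := hu
    refine hrec (fun O => e ∈ O u) ⟨O₁, hO₁, howned w hw O₁ hO₁ e (hall _ hO₁) u hlt heA⟩ ?_ O hO
    rintro O₂ hO₂ he₂ _ ⟨u', w', e', hu', heA', heu', -, rfl⟩
    have hne : e ≠ e' := by
      rintro rfl
      exact heu' (howned w hw O₂ hO₂ e (hall _ hO₂) u' hu' heA')
    exact (mem_transfer_of_ne O₂ u' w' u hne).2 he₂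
  have hnotover : ∀ i, I i → v i (O i) ≤ c i + t i := by
    rintro i ⟨O₁, hO₁, hlt⟩
    refine hrec (fun O => v i (O i) ≤ c i + t i) ⟨O₁, hO₁, ?_⟩ ?_ O hO
    · linarith [ht i]
    · rintro O₂ hO₂ hle _ ⟨u, w, e, hu, heA, -, -, rfl⟩
      by_cases hi : i = u
      · subst hi
        rw [transfer_taker, insert_eq]
        have := (hv i).2.2 {e} (O₂ i) (singleton_subset_iff.2 (hA i heA))
          ((hsub _ hO₂ i).trans (hA i))
        linarith [hs i e (hA i heA)]
      · exact ((hv i).2.1 _ _ (transfer_subset O₂ e hi) ((hsub _ hO₂ i).trans (hA i))).trans hle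
  refine ⟨fun i => if I i then A i \ O i else O i, fun i => ?_, fun e he => ?_, fun i => ?_⟩
  · dsimp only
    split_ifs
    · exact sdiff_subset.trans (hA i)
    · exact (hsub O hO i).trans (hA i)
  · obtain ⟨h1, h2⟩ := ((hmem O).1 (hCs hO)).2 e he
    by_cases hU : ∃ w, ¬ I w ∧ e ∈ O w
    · obtain ⟨w, hw, hew⟩ := hU
      refine (card_le_card fun i => ?_).trans h1
      simp only [mem_filter, mem_univ, true_and]
      split_ifs with hi
      · exact fun hi' => hkeep w hw e hew i hi (mem_sdiff.1 hi').1
      · exact id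
    · refine (card_le_card fun i => ?_).trans h2
      simp only [mem_filter, mem_univ, true_and]
      split_ifs with hi
      · exact fun hi' => mem_sdiff.1 hi'
      · exact fun hi' => absurd ⟨i, hi, hi'⟩ hU
  · dsimp only
    split_ifs with hi
    · have h1 := (hv i).2.2 (O i) (A i \ O i) ((hsub O hO i).trans (hA i))
        (sdiff_subset.trans (hA i))
      rw [union_sdiff_of_subset (hsub O hO i)] at h1
      linarith [hval i, hnotover i hi]
    · exact not_lt.1 fun hlt => hi ⟨O, hO, hlt⟩

/-- A multi-allocation of multiplicity `2 ^ k` in which every item is small can be thinned out to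
an allocation, at the cost of a factor `2 * 2 ^ k - 1`. -/
theorem exists_allocation_of_multiallocation (M : Finset α) (v : ι → Finset α → ℝ)
    (hv : ∀ i, IsValuation M (v i)) (t : ι → ℝ) (ht : ∀ i, 0 ≤ t i)
    (hs : ∀ i, ∀ e ∈ M, v i {e} ≤ t i) (k : ℕ) :
    ∀ A : ι → Finset α, (∀ i, A i ⊆ M) → (∀ e ∈ M, #{i | e ∈ A i} ≤ 2 ^ k) →
      (∀ i, (2 * 2 ^ k - 1) * t i ≤ v i (A i)) →
      ∃ B : ι → Finset α, (∀ i, B i ⊆ M) ∧ (∀ i j, i ≠ j → Disjoint (B i) (B j)) ∧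
        ∀ i, t i ≤ v i (B i) := by
  induction k with
  | zero =>
    intro A hA hm hval
    refine ⟨A, hA, fun i j hij => disjoint_left.2 fun e hi hj => hij ?_, fun i => ?_⟩
    · exact card_le_one.1 (hm e (hA i hi)) i (by simpa using hi) j (by simpa using hj)
    · have := hval i
      norm_num at this
      linarith
  | succ k ih =>
    intro A hA hm hval
    obtain ⟨B, hB, hBm, hBval⟩ := exists_halved_multiallocation M v hv t
      (fun i => (2 * 2 ^ k - 1) * t i) ht A hA (2 ^ k)
      (fun e he => (hm e he).trans (by rw [pow_succ, mul_comm])) hs fun i => by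
        refine le_trans (le_of_eq ?_) (hval i)
        ring
    exact ih B hB hBm hBval

end Transfer

theorem IsValuation.subset {α : Type*} [DecidableEq α] {M N : Finset α} {v : Finset α → ℝ}
    (hv : IsValuation M v) (h : N ⊆ M) : IsValuation N v :=
  ⟨hv.1, fun S T hST hT => hv.2.1 S T hST (hT.trans h),
    fun S T hS hT => hv.2.2 S T (hS.trans h) (hT.trans h)⟩

theorem MMS_nonneg {α : Type*} [DecidableEq α] {M : Finset α} {v : Finset α → ℝ}
    (hv : IsValuation M v) (n : ℕ) : 0 ≤ MMS M v n := by
  refine Real.sSup_nonneg ?_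
  rintro _ ⟨P, -, hunion, rfl⟩
  refine Real.iInf_nonneg fun i => ?_
  rw [← hv.1]
  exact hv.2.1 _ _ (empty_subset _) (hunion ▸ subset_biUnion_of_mem P (mem_univ i))

/-- Removing one item and one bundle does not decrease the maximin share. -/
theorem MMS_le_MMS_erase {α : Type*} [DecidableEq α] {M : Finset α} {v : Finset α → ℝ}
    (hv : IsValuation M v) {e : α} (he : e ∈ M) (n : ℕ) :
    MMS M v (n + 2) ≤ MMS (M.erase e) v (n + 1) := by
  refine csSup_le ⟨_, fun i => if i = 0 then M else ∅, fun i j hij => ?_, ?_, rfl⟩ ?_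
  · by_cases hi : i = 0
    · have hj : j ≠ 0 := fun h => hij (hi.trans h.symm)
      simp [hj]
    · simp [hi]
  · ext x
    simp only [mem_biUnion, mem_univ, true_and]
    refine ⟨fun ⟨i, hi⟩ => ?_, fun hx => ⟨0, by simpa using hx⟩⟩
    split_ifs at hi
    · exact hi
    · simp at hi
  rintro _ ⟨P, hdisj, hunion, rfl⟩
  have hPM : ∀ i, P i ⊆ M := fun i => hunion ▸ subset_biUnion_of_mem P (mem_univ i)
  obtain ⟨k, -, hk⟩ := mem_biUnion.1 (hunion.symm ▸ he)
  let Q : Fin (n + 1) → Finset α := fun j =>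
    P (k.succAbove j) ∪ if j = 0 then (P k).erase e else ∅
  have hPe : ∀ j, e ∉ P (k.succAbove j) := fun j hj =>
    disjoint_left.1 (hdisj _ _ (Fin.succAbove_ne k j)) hj hk
  have hQunion : univ.biUnion Q = M.erase e := by
    ext x
    simp only [Q, mem_biUnion, mem_univ, true_and, mem_union, mem_erase]
    constructor
    · rintro ⟨j, hj | hj⟩
      · refine ⟨?_, hPM _ hj⟩
        rintro rfl
        exact hPe j hj
      · split_ifs at hj with h0
        · exact ⟨(mem_erase.1 hj).1, hPM _ (mem_erase.1 hj).2⟩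
        · simp at hj
    · rintro ⟨hxe, hx⟩
      obtain ⟨i, -, hi⟩ := mem_biUnion.1 (hunion.symm ▸ hx)
      by_cases hik : i = k
      · subst hik
        exact ⟨0, Or.inr (by simp [hxe, hi])⟩
      · obtain ⟨j, rfl⟩ := Fin.exists_succAbove_eq hik
        exact ⟨j, Or.inl hi⟩
  have hQsub : ∀ j, Q j ⊆ M.erase e := fun j => hQunion ▸ subset_biUnion_of_mem Q (mem_univ j)
  have hQdisj : ∀ i j, i ≠ j → Disjoint (Q i) (Q j) := by
    intro i j hij
    have h1 := hdisj _ _ (fun h => hij (Fin.succAbove_right_injective h) :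
      k.succAbove i ≠ k.succAbove j)
    have h2 := fun j => (hdisj _ _ (Fin.succAbove_ne k j)).mono_right (erase_subset e (P k))
    simp only [Q, disjoint_union_left, disjoint_union_right]
    refine ⟨⟨h1, ?_⟩, ?_, ?_⟩
    · split_ifs
      · exact (h2 j).symm
      · exact disjoint_empty_left _
    · split_ifs
      · exact h2 i
      · exact disjoint_empty_right _
    · split_ifs with hi hj
      · exact absurd (hi.trans hj.symm) hij
      all_goals simp
  have hbdd : BddAbove {x : ℝ | ∃ P : Fin (n + 1) → Finset α,
      (∀ i j, i ≠ j → Disjoint (P i) (P j)) ∧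
      univ.biUnion P = M.erase e ∧ x = ⨅ i : Fin (n + 1), v (P i)} := by
    refine ⟨v M, ?_⟩
    rintro _ ⟨P', -, hu, rfl⟩
    refine (ciInf_le (Set.finite_range _).bddBelow 0).trans (hv.2.1 _ _ ?_ Subset.rfl)
    exact (hu ▸ subset_biUnion_of_mem P' (mem_univ 0)).trans (erase_subset e M)
  refine le_trans ?_ (le_csSup hbdd ⟨Q, hQdisj, hQunion, rfl⟩)
  refine le_ciInf fun j => (ciInf_le (Set.finite_range _).bddBelow (k.succAbove j)).trans ?_
  exact hv.2.1 _ _ subset_union_left ((hQsub j).trans (erase_subset e M))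

theorem stmt2 (d : ℕ) (hd : 2 ≤ d) (ρ : ℝ) (hρ : 0 < ρ)
    (H : ∀ (β : Type u) [DecidableEq β] (M : Finset β) (n : ℕ)
      (v : Fin n → Finset β → ℝ), (∀ i, IsValuation M (v i)) →
      ∃ A : Fin n → Finset β, (∀ i, A i ⊆ M) ∧
        (∀ e ∈ M, (Finset.univ.filter fun i => e ∈ A i).card ≤ d) ∧
        ∀ i, v i (A i) ≥ ρ * MMS M (v i) n) :
    ∀ (α : Type u) [DecidableEq α] (M : Finset α) (n : ℕ)
      (v : Fin n → Finset α → ℝ), (∀ i, IsValuation M (v i)) →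
      ∃ A' : Fin n → Finset α, (∀ i, A' i ⊆ M) ∧
        (∀ i j, i ≠ j → Disjoint (A' i) (A' j)) ∧
        ∀ i, v i (A' i) ≥
          ρ / (2 * (2 ^ Nat.clog 2 d : ℕ) - 1 : ℝ) * MMS M (v i) n := by
  intro α _ M n
  have hpow : (1 : ℝ) ≤ 2 ^ Nat.clog 2 d := one_le_pow₀ (by norm_num)
  have hr : 0 ≤ ρ / (2 * (2 ^ Nat.clog 2 d : ℕ) - 1 : ℝ) := by
    refine div_nonneg hρ.le ?_
    push_cast
    linarith
  induction n generalizing M with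
  | zero => exact fun v _ => ⟨fun _ => ∅, fun i => i.elim0, fun i => i.elim0, fun i => i.elim0⟩
  | succ n ih =>
    intro v hv
    by_cases hbig : ∃ i, ∃ e ∈ M,
        ρ / (2 * (2 ^ Nat.clog 2 d : ℕ) - 1 : ℝ) * MMS M (v i) (n + 1) ≤ v i {e}
    · obtain ⟨i, e, he, hie⟩ := hbig
      obtain ⟨B, hB, hBdisj, hBval⟩ := ih (M.erase e) (fun j => v (i.succAbove j))
        fun j => (hv _).subset (erase_subset e M)
      have hBe : ∀ j, e ∉ B j := fun j hj => (mem_erase.1 (hB j hj)).1 rfl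
      refine ⟨i.insertNth {e} B, fun j => ?_, fun j l hjl => ?_, fun j => ?_⟩
      · induction j using Fin.succAboveCases i with
        | x => simpa using he
        | p j => simpa using (hB j).trans (erase_subset e M)
      · induction j using Fin.succAboveCases i with
        | x =>
          induction l using Fin.succAboveCases i with
          | x => exact absurd rfl hjl
          | p l => simpa using hBe l
        | p j =>
          induction l using Fin.succAboveCases i with
          | x => simpa using hBe j
          | p l => simpa using hBdisj j l fun h => hjl (h ▸ rfl)
      · induction j using Fin.succAboveCases i with
        | x => simpa using hie
        | p j =>
          obtain ⟨m, rfl⟩ : ∃ m, n = m + 1 :=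
            Nat.exists_eq_succ_of_ne_zero (by rintro rfl; exact j.elim0)
          rw [Fin.insertNth_apply_succAbove]
          exact (mul_le_mul_of_nonneg_left (MMS_le_MMS_erase (hv _) he m) hr).trans (hBval j)
    · push Not at hbig
      obtain ⟨A, hA, hm, hval⟩ := H α M (n + 1) v hv
      refine exists_allocation_of_multiallocation M v hv _
        (fun i => mul_nonneg hr (MMS_nonneg (hv i) _)) (fun i e he => (hbig i e he).le)
        (Nat.clog 2 d) A hA (fun e he => (hm e he).trans (Nat.le_pow_clog one_lt_two d))
        fun i => le_trans (le_of_eq ?_) (hval i)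
      have : (2 * 2 ^ Nat.clog 2 d - 1 : ℝ) ≠ 0 := by linarith
      push_cast
      field_simp
end

section
/- Suppose that for every finite item set M and every profile of 4 normalized, monotone, subadditive valuations on M there exists an allocation (to 4 agents) giving each agent i a bundle of value at least (1/2)·MMS(M, v_i, 4). Then for every finite item set M, every n ≤ 8, and every profile of n normalized, monotone, subadditive valuations on M, there exists an allocation (A_1, …, A_n) with v_i(A_i) ≥ (1/6)·MMS(M, v_i, n) for every agent i. -/
open Finset

universe u

/-- `M` contains `k` pairwise disjoint bundles, each of value at least `t` under `v`. -/
def HasBundles {α : Type*} (M : Finset α) (v : Finset α → ℝ) (k : ℕ) (t : ℝ) : Prop :=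
  ∃ (J : Finset ℕ) (P : ℕ → Finset α), k ≤ J.card ∧
    (∀ i ∈ J, ∀ j ∈ J, i ≠ j → Disjoint (P i) (P j)) ∧
    ∀ j ∈ J, P j ⊆ M ∧ t ≤ v (P j)

/-- The items of `M` can be allocated to the agents in `I` so that agent `i` receives value at
least `t i`. -/
def Allocable {α ι : Type*} (I : Finset ι) (M : Finset α) (v : ι → Finset α → ℝ)
    (t : ι → ℝ) : Prop :=
  ∃ A : ι → Finset α, (∀ i ∈ I, A i ⊆ M) ∧
    (∀ i ∈ I, ∀ j ∈ I, i ≠ j → Disjoint (A i) (A j)) ∧ ∀ i ∈ I, t i ≤ v i (A i)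

/-- Any `k` agents, each with `K` disjoint bundles of value `t i`, can be given half of `t i`. -/
def HalfSolvable (α ι : Type*) [DecidableEq α] (k K : ℕ) : Prop :=
  ∀ (M : Finset α) (I : Finset ι) (v : ι → Finset α → ℝ) (t : ι → ℝ), I.card = k →
    (∀ i ∈ I, IsValuation M (v i)) → (∀ i ∈ I, 0 ≤ t i) →
    (∀ i ∈ I, HasBundles M (v i) K (t i)) → Allocable I M v (fun i => t i / 2)

section

variable {α ι : Type*}

lemma HasBundles.mono {M : Finset α} {v : Finset α → ℝ} {k K : ℕ} {t s : ℝ}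
    (h : HasBundles M v K t) (hk : k ≤ K) (hs : s ≤ t) : HasBundles M v k s := by
  obtain ⟨J, P, hJ, hd, hP⟩ := h
  exact ⟨J, P, hk.trans hJ, hd, fun j hj => ⟨(hP j hj).1, hs.trans (hP j hj).2⟩⟩

lemma Allocable.mono {I : Finset ι} {M : Finset α} {v : ι → Finset α → ℝ} {s t : ι → ℝ}
    (h : Allocable I M v t) (hs : ∀ i ∈ I, s i ≤ t i) : Allocable I M v s := by
  obtain ⟨A, hA, hd, ht⟩ := h
  exact ⟨A, hA, hd, fun i hi => (hs i hi).trans (ht i hi)⟩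

lemma Allocable.union [DecidableEq ι] {I I' : Finset ι} {M N N' : Finset α}
    {v : ι → Finset α → ℝ} {t : ι → ℝ} (h : Allocable I N v t) (h' : Allocable I' N' v t)
    (hN : N ⊆ M) (hN' : N' ⊆ M) (hd : Disjoint N N') : Allocable (I ∪ I') M v t := by
  obtain ⟨A, hA, hAd, hAt⟩ := h
  obtain ⟨B, hB, hBd, hBt⟩ := h'
  have hmem : ∀ i ∈ I ∪ I', i ∉ I → i ∈ I' := fun i hi hi' => (mem_union.1 hi).resolve_left hi'
  refine ⟨fun i => if i ∈ I then A i else B i, fun i hi => ?_, fun i hi j hj hij => ?_,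
    fun i hi => ?_⟩
  · by_cases h : i ∈ I
    · simpa [h] using (hA i h).trans hN
    · simpa [h] using (hB i (hmem i hi h)).trans hN'
  · by_cases h : i ∈ I <;> by_cases h' : j ∈ I <;> simp only [h, h', if_true, if_false]
    · exact hAd i h j h' hij
    · exact hd.mono (hA i h) (hB j (hmem j hj h'))
    · exact (hd.mono (hA j h') (hB i (hmem i hi h))).symm
    · exact hBd i (hmem i hi h) j (hmem j hj h') hij
  · by_cases h : i ∈ I
    · simpa [h] using hAt i h
    · simpa [h] using hBt i (hmem i hi h)

lemma HasBundles.of_subset {M N : Finset α} {v : Finset α → ℝ} {k : ℕ} {t : ℝ}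
    (h : HasBundles N v k t) (hN : N ⊆ M) : HasBundles M v k t := by
  obtain ⟨J, P, hJ, hd, hP⟩ := h
  exact ⟨J, P, hJ, hd, fun j hj => ⟨(hP j hj).1.trans hN, (hP j hj).2⟩⟩

variable [DecidableEq α]

lemma IsValuation.nonneg {M S : Finset α} {v : Finset α → ℝ} (hv : IsValuation M v)
    (hS : S ⊆ M) : 0 ≤ v S := by
  rw [← hv.1]
  exact hv.2.1 _ _ (empty_subset _) hS

lemma IsValuation.restrict {M N : Finset α} {v : Finset α → ℝ} (hv : IsValuation M v)
    (h : N ⊆ M) : IsValuation N v :=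
  ⟨hv.1, fun S T hST hT => hv.2.1 S T hST (hT.trans h),
    fun S T hS hT => hv.2.2 S T (hS.trans h) (hT.trans h)⟩

lemma bddAbove_MMS {M : Finset α} {v : Finset α → ℝ} (hv : IsValuation M v) {k : ℕ}
    (hk : 0 < k) : BddAbove {x : ℝ | ∃ P : Fin k → Finset α,
      (∀ i j, i ≠ j → Disjoint (P i) (P j)) ∧
      Finset.univ.biUnion P = M ∧ x = ⨅ i : Fin k, v (P i)} := by
  refine ⟨v M, ?_⟩
  rintro x ⟨P, -, hM, rfl⟩
  refine (ciInf_le (Set.finite_range _).bddBelow ⟨0, hk⟩).trans (hv.2.1 _ _ ?_ subset_rfl)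
  rw [← hM]
  exact subset_biUnion_of_mem P (mem_univ _)

lemma HasBundles.le_MMS {M : Finset α} {v : Finset α → ℝ} (hv : IsValuation M v) {k : ℕ}
    (hk : 0 < k) {t : ℝ} (h : HasBundles M v k t) : t ≤ MMS M v k := by
  obtain ⟨J, P, hJ, hd, hP⟩ := h
  obtain ⟨J', hJ', rfl⟩ := exists_subset_card_eq hJ
  let e := J'.equivFin
  let Q : Fin J'.card → Finset α := fun i => P (e.symm i)
  have hQM : ∀ i, Q i ⊆ M := fun i => (hP _ (hJ' (e.symm i).2)).1
  have hQd : ∀ i j, i ≠ j → Disjoint (Q i) (Q j) := fun i j hij =>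
    hd _ (hJ' (e.symm i).2) _ (hJ' (e.symm j).2) fun h => hij (e.symm.injective (Subtype.ext h))
  let z : Fin J'.card := ⟨0, hk⟩
  let L : Finset α := M \ univ.biUnion Q
  have hL : ∀ i, Disjoint L (Q i) := fun i =>
    disjoint_sdiff_self_left.mono_right (subset_biUnion_of_mem Q (mem_univ i))
  let R : Fin J'.card → Finset α := fun i => if i = z then Q i ∪ L else Q i
  have hQR : ∀ i, Q i ⊆ R i := fun i => by
    by_cases h : i = z <;> simp [R, h]
  have hRM : ∀ i, R i ⊆ M := fun i => by
    by_cases h : i = z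
    · simpa [R, h] using union_subset (hQM z) sdiff_subset
    · simpa [R, h] using hQM i
  have hne : Nonempty (Fin J'.card) := ⟨z⟩
  have hR : t ≤ ⨅ i, v (R i) := le_ciInf fun i =>
    (hP _ (hJ' (e.symm i).2)).2.trans (hv.2.1 _ _ (hQR i) (hRM i))
  refine hR.trans (le_csSup (bddAbove_MMS hv hk) ⟨R, fun i j hij => ?_, ?_, rfl⟩)
  · by_cases hi : i = z <;> by_cases hj : j = z <;> simp only [R, hi, hj, if_true, if_false]
    · exact absurd (hi.trans hj.symm) hij
    · exact disjoint_union_left.2 ⟨hQd _ _ (hi ▸ hij), hL j⟩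
    · exact disjoint_union_right.2 ⟨hQd _ _ (hj ▸ hij), (hL i).symm⟩
    · exact hQd _ _ hij
  · refine Subset.antisymm (biUnion_subset.2 fun i _ => hRM i) fun x hx => ?_
    by_cases h : x ∈ univ.biUnion Q
    · obtain ⟨i, -, hi⟩ := mem_biUnion.1 h
      exact mem_biUnion.2 ⟨i, mem_univ _, hQR i hi⟩
    · exact mem_biUnion.2 ⟨z, mem_univ _, by
        simp only [R, if_true]
        exact mem_union_right _ (mem_sdiff.2 ⟨hx, h⟩)⟩

lemma MMS_nonneg_and_hasBundles {M : Finset α} {v : Finset α → ℝ} (hv : IsValuation M v) {k : ℕ}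
    (hk : 0 < k) : 0 ≤ MMS M v k ∧ HasBundles M v k (MMS M v k) := by
  have hne : Nonempty (Fin k) := ⟨⟨0, hk⟩⟩
  have hfin : {x : ℝ | ∃ P : Fin k → Finset α,
      (∀ i j, i ≠ j → Disjoint (P i) (P j)) ∧
      Finset.univ.biUnion P = M ∧ x = ⨅ i : Fin k, v (P i)}.Finite := by
    refine ((Fintype.piFinset fun _ : Fin k => M.powerset).image
      fun P => ⨅ i, v (P i)).finite_toSet.subset ?_
    rintro x ⟨P, -, hM, rfl⟩
    refine mem_coe.2 (mem_image_of_mem _ (Fintype.mem_piFinset.2 fun i => mem_powerset.2 ?_))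
    rw [← hM]
    exact subset_biUnion_of_mem P (mem_univ i)
  have hnonempty : {x : ℝ | ∃ P : Fin k → Finset α,
      (∀ i j, i ≠ j → Disjoint (P i) (P j)) ∧
      Finset.univ.biUnion P = M ∧ x = ⨅ i : Fin k, v (P i)}.Nonempty := by
    refine ⟨_, fun i => if i = ⟨0, hk⟩ then M else ∅, fun i j hij => ?_, ?_, rfl⟩
    · by_cases hi : i = ⟨0, hk⟩ <;> by_cases hj : j = ⟨0, hk⟩ <;> simp [hi, hj]
      exact absurd (hi.trans hj.symm) hij
    · ext x
      simp only [mem_biUnion, mem_univ, true_and]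
      refine ⟨fun ⟨i, hi⟩ => ?_, fun hx => ⟨⟨0, hk⟩, by simpa using hx⟩⟩
      by_contra hx
      split_ifs at hi <;> simp_all
  obtain ⟨P, hd, hM, hx⟩ := hnonempty.csSup_mem hfin
  change MMS M v k = _ at hx
  have hPM : ∀ i, P i ⊆ M := fun i => hM ▸ subset_biUnion_of_mem P (mem_univ i)
  constructor
  · rw [hx]
    exact le_ciInf fun i => hv.nonneg (hPM i)
  · refine ⟨range k, fun j => if h : j < k then P ⟨j, h⟩ else ∅, by simp,
      fun i hi j hj hij => ?_, fun j hj => ?_⟩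
    · simp only [mem_range] at hi hj
      simpa [hi, hj] using hd ⟨i, hi⟩ ⟨j, hj⟩ (by simpa using hij)
    · simp only [mem_range] at hj
      simp only [hj, dif_pos]
      exact ⟨hPM _, hx ▸ ciInf_le (Set.finite_range _).bddBelow _⟩

lemma halfSolvable_one : HalfSolvable α ι 1 1 := by
  intro M I v t hI hv ht hb
  obtain ⟨i, rfl⟩ := card_eq_one.1 hI
  obtain ⟨J, P, hJ, -, hP⟩ := hb i (by simp)
  obtain ⟨j, hj⟩ := card_pos.1 hJ
  refine ⟨fun _ => P j, fun _ _ => (hP j hj).1, ?_, ?_⟩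
  · intro a ha b hb hab
    simp_all
  · intro a ha
    rw [mem_singleton.1 ha]
    have := ht i (by simp)
    linarith [(hP j hj).2]

lemma halfSolvable_two : HalfSolvable α ι 2 2 := by
  classical
  intro M I v t hI hv ht hb
  obtain ⟨i, j, hij, rfl⟩ := card_eq_two.1 hI
  have hi : i ∈ ({i, j} : Finset ι) := by simp
  have hj : j ∈ ({i, j} : Finset ι) := by simp
  obtain ⟨J, P, hJ, hd, hP⟩ := hb i hi
  obtain ⟨a, ha, b, hb', hab⟩ := one_lt_card.1 hJ
  obtain ⟨J', P', hJ', -, hP'⟩ := hb j hj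
  obtain ⟨c, hc⟩ := card_pos.1 (show 0 < J'.card by omega)
  have hM : t j ≤ v j M := (hP' c hc).2.trans ((hv j hj).2.1 _ _ (hP' c hc).1 subset_rfl)
  have hsub := (hv j hj).2.2 (P a) (M \ P a) (hP a ha).1 sdiff_subset
  rw [union_sdiff_of_subset (hP a ha).1] at hsub
  have hb2 : t i ≤ v i (M \ P a) := (hP b hb').2.trans ((hv i hi).2.1 _ _
    (subset_sdiff.2 ⟨(hP b hb').1, hd b hb' a ha hab.symm⟩) sdiff_subset)
  have hti := ht i hi
  have key : ∀ X Y : Finset α, X ⊆ M → Y ⊆ M → Disjoint X Y → t i / 2 ≤ v i X →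
      t j / 2 ≤ v j Y → Allocable {i, j} M v (fun i => t i / 2) := by
    intro X Y hX hY hXY h1 h2
    refine ⟨fun k => if k = i then X else Y, ?_, ?_, ?_⟩
    · intro k hk
      dsimp only
      split_ifs <;> assumption
    · intro k hk l hl hkl
      simp only [mem_insert, mem_singleton] at hk hl
      rcases hk with rfl | rfl <;> rcases hl with rfl | rfl
      · exact absurd rfl hkl
      · simpa [hij.symm] using hXY
      · simpa [hij.symm] using hXY.symm
      · exact absurd rfl hkl
    · intro k hk
      simp only [mem_insert, mem_singleton] at hk
      rcases hk with rfl | rfl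
      · simpa using h1
      · simpa [hij.symm] using h2
  by_cases h : t j / 2 ≤ v j (P a)
  · exact key (M \ P a) (P a) sdiff_subset (hP a ha).1 disjoint_sdiff_self_left
      (by linarith) h
  · exact key (P a) (M \ P a) (hP a ha).1 sdiff_subset disjoint_sdiff_self_right
      (by linarith [(hP a ha).2]) (by linarith)

lemma HasBundles.inter_or_sdiff {M S : Finset α} {v : Finset α → ℝ} (hv : IsValuation M v)
    {n K L : ℕ} {t : ℝ} (h : HasBundles M v n t) (hKL : K + L ≤ n + 1) :
    HasBundles (M ∩ S) v K (t / 2) ∨ HasBundles (M \ S) v L (t / 2) := by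
  classical
  obtain ⟨J, P, hJ, hd, hP⟩ := h
  by_cases hK : K ≤ (J.filter fun j => t / 2 ≤ v (P j ∩ S)).card
  · refine Or.inl ⟨_, fun j => P j ∩ S, hK, fun i hi j hj hij => ?_, fun j hj => ?_⟩
    · exact (hd i (mem_filter.1 hi).1 j (mem_filter.1 hj).1 hij).mono inter_subset_left
        inter_subset_left
    · exact ⟨inter_subset_inter_right (hP j (mem_filter.1 hj).1).1, (mem_filter.1 hj).2⟩
  · refine Or.inr ⟨J.filter fun j => ¬ t / 2 ≤ v (P j ∩ S), fun j => P j \ S, ?_,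
      fun i hi j hj hij => ?_, fun j hj => ?_⟩
    · have := J.card_filter_add_card_filter_not fun j => t / 2 ≤ v (P j ∩ S)
      omega
    · exact (hd i (mem_filter.1 hi).1 j (mem_filter.1 hj).1 hij).mono sdiff_subset sdiff_subset
    · obtain ⟨hjJ, hj'⟩ := mem_filter.1 hj
      have hjM := (hP j hjJ).1
      refine ⟨sdiff_subset_sdiff hjM subset_rfl, ?_⟩
      have := hv.2.2 (P j ∩ S) (P j \ S) (inter_subset_left.trans hjM) (sdiff_subset.trans hjM)
      rw [union_comm, sdiff_union_inter] at this
      linarith [(hP j hjJ).2]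

lemma HasBundles.erase_item {M : Finset α} {v : Finset α → ℝ} (hv : IsValuation M v)
    {k : ℕ} {t s : ℝ} {g : α} (hg : g ∈ M) (hs : v {g} ≤ s) (h : HasBundles M v k t) :
    HasBundles (M.erase g) v k (t - s) := by
  obtain ⟨J, P, hJ, hd, hP⟩ := h
  refine ⟨J, fun j => (P j).erase g, hJ, fun i hi j hj hij =>
    (hd i hi j hj hij).mono (erase_subset _ _) (erase_subset _ _), fun j hj =>
    ⟨erase_subset_erase _ (hP j hj).1, ?_⟩⟩
  have hg' : {g} ⊆ M := singleton_subset_iff.2 hg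
  have hj' := (erase_subset g (P j)).trans (hP j hj).1
  have h1 := hv.2.2 {g} ((P j).erase g) hg' hj'
  have h2 := hv.2.1 (P j) ({g} ∪ (P j).erase g) (fun x hx => by
    by_cases h : x = g <;> simp [h, hx]) (union_subset hg' hj')
  linarith [(hP j hj).2]

lemma HasBundles.erase_bundle {M : Finset α} {v : Finset α → ℝ} {k : ℕ} {t : ℝ} (g : α)
    (h : HasBundles M v (k + 1) t) : HasBundles (M.erase g) v k t := by
  classical
  obtain ⟨J, P, hJ, hd, hP⟩ := h
  refine ⟨J.filter fun j => g ∉ P j, P, ?_, fun i hi j hj hij =>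
    hd i (mem_filter.1 hi).1 j (mem_filter.1 hj).1 hij, fun j hj => ?_⟩
  · have h1 := J.card_filter_add_card_filter_not fun j => g ∉ P j
    have h2 : (J.filter fun j => ¬ g ∉ P j).card ≤ 1 := by
      refine card_le_one.2 fun i hi j hj => ?_
      simp only [mem_filter, not_not] at hi hj
      by_contra hij
      exact disjoint_left.1 (hd i hi.1 j hj.1 hij) hi.2 hj.2
    omega
  · obtain ⟨hjJ, hj'⟩ := mem_filter.1 hj
    exact ⟨subset_erase.2 ⟨(hP j hjJ).1, hj'⟩, (hP j hjJ).2⟩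

/-- When single items are worth less than a sixth of the target, two half-solvable group sizes
can be combined, at the price of a factor `1 / 3`. -/
lemma HalfSolvable.combine {a b K L : ℕ} (hab : HalfSolvable α ι a K)
    (hbL : HalfSolvable α ι b L) (hKL : K + L ≤ a + b + 1) (hK : K ≤ a + b) (hL : L ≤ a + b)
    {M : Finset α} {I : Finset ι} {v : ι → Finset α → ℝ} {t : ι → ℝ} (hI : I.card = a + b)
    (hv : ∀ i ∈ I, IsValuation M (v i)) (ht : ∀ i ∈ I, 0 ≤ t i)
    (hb : ∀ i ∈ I, HasBundles M (v i) (a + b) (t i))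
    (hsmall : ∀ i ∈ I, ∀ g ∈ M, v i {g} ≤ t i / 6) :
    Allocable I M v (fun i => t i / 6) := by
  classical
  let happy : Finset α → Finset ι := fun S => I.filter fun i =>
    HasBundles (M ∩ S) (v i) K (t i / 2)
  have hfull : a ≤ (happy M).card := by
    have : happy M = I := filter_true_of_mem fun i hi => by
      rw [inter_self]
      exact (hb i hi).mono hK (by linarith [ht i hi])
    rw [this]
    omega
  obtain ⟨S, hS, hmin⟩ := (M.powerset.filter fun S => a ≤ (happy S).card).exists_minimal
    ⟨M, by simpa using hfull⟩
  simp only [mem_filter, mem_powerset] at hS hmin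
  obtain ⟨I₀, hI₀, hcard, hright⟩ : ∃ I₀ ⊆ happy S, I₀.card = a ∧
      ∀ i ∈ I \ I₀, HasBundles (M \ S) (v i) L (t i / 3) := by
    rcases S.eq_empty_or_nonempty with rfl | ⟨g, hg⟩
    · obtain ⟨I₀, h, hc⟩ := exists_subset_card_eq hS.2
      refine ⟨I₀, h, hc, fun i hi => ?_⟩
      have hi := (mem_sdiff.1 hi).1
      rw [sdiff_empty]
      exact (hb i hi).mono hL (by linarith [ht i hi])
    · have hgM := hS.1 hg
      have hlt : (happy (S.erase g)).card < a := by
        by_contra hle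
        exact notMem_erase g S
          (hmin ⟨(erase_subset _ _).trans hS.1, not_lt.1 hle⟩ (erase_subset _ _) hg)
      have hmono : happy (S.erase g) ⊆ happy S := fun i hi => by
        simp only [happy, mem_filter] at hi ⊢
        exact ⟨hi.1, hi.2.of_subset (inter_subset_inter_left (erase_subset _ _))⟩
      obtain ⟨I₀, h1, h2, hc⟩ := exists_subsuperset_card_eq hmono hlt.le hS.2
      refine ⟨I₀, h2, hc, fun i hi => ?_⟩
      obtain ⟨hi, hi'⟩ := mem_sdiff.1 hi
      have hn : ¬ HasBundles (M ∩ S.erase g) (v i) K (t i / 2) := fun h =>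
        hi' (h1 (mem_filter.2 ⟨hi, h⟩))
      have h3 := ((hb i hi).inter_or_sdiff (hv i hi) hKL).resolve_left hn
      have h4 := h3.erase_item ((hv i hi).restrict sdiff_subset)
        (mem_sdiff.2 ⟨hgM, notMem_erase g S⟩) (hsmall i hi g hgM)
      refine (h4.of_subset ?_).mono le_rfl (by linarith)
      intro x hx
      simp only [mem_erase, mem_sdiff] at hx ⊢
      tauto
  have hI₀I : I₀ ⊆ I := hI₀.trans (filter_subset _ _)
  have hleft := hab (M ∩ S) I₀ v (fun i => t i / 2) hcard
    (fun i hi => (hv i (hI₀I hi)).restrict inter_subset_left)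
    (fun i hi => by linarith [ht i (hI₀I hi)]) (fun i hi => (mem_filter.1 (hI₀ hi)).2)
  have hright' := hbL (M \ S) (I \ I₀) v (fun i => t i / 3)
    (by rw [card_sdiff_of_subset hI₀I]; omega)
    (fun i hi => (hv i (sdiff_subset hi)).restrict sdiff_subset)
    (fun i hi => by linarith [ht i (sdiff_subset hi)]) hright
  rw [← union_sdiff_of_subset hI₀I]
  exact (hleft.mono fun i hi => by linarith [ht i (hI₀I hi)]).union
    (hright'.mono fun i hi => by linarith) inter_subset_left sdiff_subset
    (disjoint_sdiff_self_right.mono_left inter_subset_right)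

lemma allocable_sixth (h₃ : HalfSolvable α ι 3 4) (h₄ : HalfSolvable α ι 4 4) (n : ℕ) (hn : n ≤ 8)
    (M : Finset α) (I : Finset ι) (v : ι → Finset α → ℝ) (t : ι → ℝ) (hI : I.card = n)
    (hv : ∀ i ∈ I, IsValuation M (v i)) (ht : ∀ i ∈ I, 0 ≤ t i)
    (hb : ∀ i ∈ I, HasBundles M (v i) n (t i)) : Allocable I M v (fun i => t i / 6) := by
  classical
  induction n generalizing M I with
  | zero =>
    rw [card_eq_zero.1 hI]
    exact ⟨fun _ => ∅, by simp, by simp, by simp⟩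
  | succ n ih =>
    by_cases hlarge : ∃ i ∈ I, ∃ g ∈ M, t i / 6 ≤ v i {g}
    · obtain ⟨i, hi, g, hg, hig⟩ := hlarge
      have hrest := ih (by omega) (M.erase g) (I.erase i) (by rw [card_erase_of_mem hi]; omega)
        (fun j hj => (hv j (mem_of_mem_erase hj)).restrict (erase_subset _ _))
        (fun j hj => ht j (mem_of_mem_erase hj))
        (fun j hj => (hb j (mem_of_mem_erase hj)).erase_bundle g)
      have hone : Allocable {i} {g} v (fun i => t i / 6) :=
        ⟨fun _ => {g}, by simp, by simp +contextual, by simpa using hig⟩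
      have := hone.union hrest (singleton_subset_iff.2 hg) (erase_subset _ _) (by simp)
      rwa [singleton_union, insert_erase hi] at this
    · have hsmall : ∀ i ∈ I, ∀ g ∈ M, v i {g} ≤ t i / 6 := fun i hi g hg =>
        (not_le.1 fun h => hlarge ⟨i, hi, g, hg, h⟩).le
      have h₁ : HalfSolvable α ι 1 1 := halfSolvable_one
      have h₂ : HalfSolvable α ι 2 2 := halfSolvable_two
      have direct : ∀ {k}, HalfSolvable α ι k k → n + 1 = k →
          Allocable I M v (fun i => t i / 6) := fun h hk =>
        (h M I v t (hI.trans hk) hv ht (hk ▸ hb)).mono fun i hi => by linarith [ht i hi]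
      have split : ∀ {a b K L}, HalfSolvable α ι a K → HalfSolvable α ι b L → n + 1 = a + b →
          K + L ≤ a + b + 1 → K ≤ a + b → L ≤ a + b → Allocable I M v (fun i => t i / 6) :=
        fun ha hb' hk hKL hK hL =>
          ha.combine hb' hKL hK hL (hI.trans hk) hv ht (hk ▸ hb) hsmall
      have hn' : n = 0 ∨ n = 1 ∨ n = 2 ∨ n = 3 ∨ n = 4 ∨ n = 5 ∨ n = 6 ∨ n = 7 := by omega
      rcases hn' with h | h | h | h | h | h | h | h
      · exact direct h₁ (by omega)
      · exact direct h₂ (by omega)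
      · exact split h₁ h₂ (by omega) (by omega) (by omega) (by omega)
      · exact direct h₄ (by omega)
      · exact split h₁ h₄ (by omega) (by omega) (by omega) (by omega)
      · exact split h₂ h₄ (by omega) (by omega) (by omega) (by omega)
      · exact split h₃ h₄ (by omega) (by omega) (by omega) (by omega)
      · exact split h₄ h₄ (by omega) (by omega) (by omega) (by omega)

/-- Fewer than four agents are handled by duplicating agents. -/
lemma halfSolvable_of_four
    (H : ∀ (M : Finset α) (v : Fin 4 → Finset α → ℝ), (∀ i, IsValuation M (v i)) →
      ∃ A : Fin 4 → Finset α, (∀ i, A i ⊆ M) ∧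
        (∀ i j, i ≠ j → Disjoint (A i) (A j)) ∧
        ∀ i, v i (A i) ≥ (1 / 2) * MMS M (v i) 4)
    {k : ℕ} (hk₀ : 0 < k) (hk : k ≤ 4) : HalfSolvable α ι k 4 := by
  classical
  intro M I v t hI hv ht hb
  obtain ⟨i₀, hi₀⟩ := card_pos.1 (hI.symm ▸ hk₀)
  have : Nonempty I := ⟨⟨i₀, hi₀⟩⟩
  obtain ⟨s⟩ : Nonempty (I ↪ Fin 4) :=
    Function.Embedding.nonempty_of_card_le (by simpa [hI] using hk)
  let f : Fin 4 → I := Function.invFun s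
  have hf : ∀ i, f (s i) = i := Function.leftInverse_invFun s.injective
  obtain ⟨A, hA, hd, hval⟩ := H M (fun x => v (f x)) fun x => hv _ (f x).2
  refine ⟨fun i => if h : i ∈ I then A (s ⟨i, h⟩) else ∅, fun i hi => ?_,
    fun i hi j hj hij => ?_, fun i hi => ?_⟩
  · simpa [hi] using hA _
  · simpa [hi, hj] using hd _ _ fun h => hij (congrArg Subtype.val (s.injective h))
  · have h1 := hval (s ⟨i, hi⟩)
    rw [hf] at h1
    have h2 := (hb i hi).le_MMS (hv i hi) (by norm_num)
    simp only [hi, dif_pos]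
    linarith

end

theorem stmt3
    (H : ∀ (β : Type u) [DecidableEq β] (M : Finset β)
      (v : Fin 4 → Finset β → ℝ), (∀ i, IsValuation M (v i)) →
      ∃ A : Fin 4 → Finset β, (∀ i, A i ⊆ M) ∧
        (∀ i j, i ≠ j → Disjoint (A i) (A j)) ∧
        ∀ i, v i (A i) ≥ (1 / 2) * MMS M (v i) 4) :
    ∀ (α : Type u) [DecidableEq α] (M : Finset α) (n : ℕ), n ≤ 8 →
      ∀ (v : Fin n → Finset α → ℝ), (∀ i, IsValuation M (v i)) →
      ∃ A : Fin n → Finset α, (∀ i, A i ⊆ M) ∧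
        (∀ i j, i ≠ j → Disjoint (A i) (A j)) ∧
        ∀ i, v i (A i) ≥ (1 / 6) * MMS M (v i) n := by
  intro α _ M n hn v hv
  obtain ⟨A, hA, hd, ht⟩ := allocable_sixth (halfSolvable_of_four (H α) (by norm_num) (by norm_num))
    (halfSolvable_of_four (H α) (by norm_num) le_rfl) n hn M univ v (fun i => MMS M (v i) n)
    (by simp) (fun i _ => hv i) (fun i _ => (MMS_nonneg_and_hasBundles (hv i) i.pos).1)
    (fun i _ => (MMS_nonneg_and_hasBundles (hv i) i.pos).2)
  refine ⟨A, fun i => hA i (mem_univ i), fun i j => hd i (mem_univ i) j (mem_univ j), fun i => ?_⟩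
  linarith [ht i (mem_univ i)]
end

section
/- Let M be a finite set of items and let v be a normalized, monotone valuation on M. Then ω(S_p, M, v) ≥ ω(S_q, M, v); that is, in the alternating picking game, the value that player p can guarantee when p picks first is at least the value that p can guarantee when q picks first. -/
open Finset

/-- The value, for player `p`, of the alternating picking game with `v` the valuation of `p`,
`R` the remaining items, `T` the set of items already picked by `p`, where the Bool indicates
whether it is `p`'s turn (`true`) or `q`'s turn (`false`). The first (fuel) argument is
intended to be `R.card`, so the recursion bottoms out exactly when `R = ∅`. -/
noncomputable def pickVal {α : Type*} [DecidableEq α] (v : Finset α → ℝ) :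
    ℕ → Bool → Finset α → Finset α → ℝ
  | 0, _, _, T => v T
  | k + 1, b, R, T =>
    if hR : R.Nonempty then
      if b then
        (R.image fun e => pickVal v k false (R.erase e) (insert e T)).max' (hR.image _)
      else
        (R.image fun e => pickVal v k true (R.erase e) T).min' (hR.image _)
    else v T

/-- `ω(S_p, M, v)`: the maximin value that player `p` can guarantee in the alternating
picking game over `M` in which `p` picks first. -/
noncomputable def omegaP {α : Type*} [DecidableEq α] (M : Finset α) (v : Finset α → ℝ) : ℝ :=
  pickVal v M.card true M ∅

/-- `ω(S_q, M, v)`: the maximin value that player `p` can guarantee in the alternating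
picking game over `M` in which `q` picks first. -/
noncomputable def omegaQ {α : Type*} [DecidableEq α] (M : Finset α) (v : Finset α → ℝ) : ℝ :=
  pickVal v M.card false M ∅

section PickVal

variable {α : Type*} [DecidableEq α] {v : Finset α → ℝ} {R : Finset α} {e : α}

lemma pickVal_false_le (v : Finset α → ℝ) (k : ℕ) (T : Finset α) (he : e ∈ R) :
    pickVal v (k + 1) false R T ≤ pickVal v k true (R.erase e) T := by
  have hR : R.Nonempty := ⟨e, he⟩
  simp only [pickVal, hR, dite_true, Bool.false_eq_true, if_false]
  exact Finset.min'_le _ _ (Finset.mem_image_of_mem _ he)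

lemma le_pickVal_true (v : Finset α → ℝ) (k : ℕ) (T : Finset α) (he : e ∈ R) :
    pickVal v k false (R.erase e) (insert e T) ≤ pickVal v (k + 1) true R T := by
  have hR : R.Nonempty := ⟨e, he⟩
  simp only [pickVal, hR, dite_true, if_true]
  exact Finset.le_max' _ _
    (Finset.mem_image_of_mem (fun e => pickVal v k false (R.erase e) (insert e T)) he)

lemma exists_pickVal_false_eq (v : Finset α → ℝ) (k : ℕ) (T : Finset α) (hR : R.Nonempty) :
    ∃ e ∈ R, pickVal v k true (R.erase e) T = pickVal v (k + 1) false R T := by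
  simp only [pickVal, hR, dite_true, Bool.false_eq_true, if_false]
  exact Finset.mem_image.mp (Finset.min'_mem _ (hR.image _))

lemma exists_pickVal_true_eq (v : Finset α → ℝ) (k : ℕ) (T : Finset α) (hR : R.Nonempty) :
    ∃ e ∈ R, pickVal v k false (R.erase e) (insert e T) = pickVal v (k + 1) true R T := by
  simp only [pickVal, hR, dite_true, if_true]
  exact Finset.mem_image.mp (Finset.max'_mem _ (hR.image _))

/-- Removing a remaining item from the game, whoever is to move, does not help player `p`. -/
lemma pickVal_erase_le {M : Finset α}
    (hmono : ∀ S T : Finset α, S ⊆ T → T ⊆ M → v S ≤ v T) (n : ℕ) :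
    ∀ R T : Finset α, R.card = n + 1 → R ⊆ M → T ⊆ M → ∀ f ∈ R, ∀ b,
      pickVal v n b (R.erase f) T ≤ pickVal v (n + 1) b R T := by
  induction n with
  | zero =>
    intro R T _ hR hT f hf b
    cases b with
    | false =>
      obtain ⟨g, -, hg⟩ := exists_pickVal_false_eq v 0 T ⟨f, hf⟩
      exact hg.le
    | true =>
      exact (hmono T (insert f T) (Finset.subset_insert f T) (insert_subset (hR hf) hT)).trans
        (le_pickVal_true v 0 T hf)
  | succ n ih =>
    intro R T hcard hR hT f hf b
    have herase (g : α) (hg : g ∈ R) : (R.erase g).card = n + 1 := by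
      rw [card_erase_of_mem hg, hcard, Nat.add_sub_cancel]
    have hsub (g : α) : R.erase g ⊆ M := (erase_subset g R).trans hR
    have hne : (R.erase f).Nonempty := card_pos.mp (by rw [herase f hf]; exact n.succ_pos)
    cases b with
    | false =>
      obtain ⟨g, hg, hgeq⟩ := exists_pickVal_false_eq v (n + 1) T ⟨f, hf⟩
      rw [← hgeq]
      by_cases hfg : g = f
      · subst hfg
        obtain ⟨x, hx⟩ := hne
        exact (pickVal_false_le v n T hx).trans
          (ih _ T (herase g hg) (hsub g) hT x hx true)
      · refine (pickVal_false_le v n T (mem_erase.mpr ⟨hfg, hg⟩)).trans ?_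
        rw [erase_right_comm]
        exact ih _ T (herase g hg) (hsub g) hT f (mem_erase.mpr ⟨Ne.symm hfg, hf⟩) true
    | true =>
      obtain ⟨e, he, heq⟩ := exists_pickVal_true_eq v n T hne
      obtain ⟨hef, heR⟩ := mem_erase.mp he
      rw [← heq, erase_right_comm]
      exact (ih _ (insert e T) (herase e heR) (hsub e) (insert_subset (hR heR) hT) f
        (mem_erase.mpr ⟨hef.symm, hf⟩) false).trans (le_pickVal_true v (n + 1) T heR)

end PickVal

theorem stmt6 {α : Type*} [DecidableEq α] (M : Finset α) (v : Finset α → ℝ)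
    (hnorm : v ∅ = 0) (hmono : ∀ S T : Finset α, S ⊆ T → T ⊆ M → v S ≤ v T) :
    omegaP M v ≥ omegaQ M v := by
  unfold omegaP omegaQ
  rcases M.eq_empty_or_nonempty with rfl | ⟨f, hf⟩
  · simp [pickVal]
  · obtain ⟨n, hn⟩ := Nat.exists_eq_succ_of_ne_zero (card_ne_zero_of_mem hf)
    rw [hn]
    exact (pickVal_false_le v n ∅ hf).trans
      (pickVal_erase_le hmono n M ∅ hn Subset.rfl (empty_subset M) f hf true)
end

section
/- Let M be a finite set of items and let v be a normalized, monotone, subadditive valuation on M. Then ω(S_p, M, v) + ω(S_q, M, v) ≥ v(M). -/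
open Finset

/-- Two copies of the game on the same remaining items `R`, one with `p` to move and one with `q`
to move: `p` can copy the picks of `q` from each game into the other, so that the two sets `p` ends
up with cover all the items. -/
theorem le_pickVal_true_add_pickVal_false {α : Type*} [DecidableEq α] {M : Finset α}
    {v : Finset α → ℝ} (hv : ∀ S T : Finset α, S ⊆ M → T ⊆ M → v (S ∪ T) ≤ v S + v T) (k : ℕ) :
    ∀ R T₁ T₂ : Finset α, R.card = k → T₁ ⊆ M → T₂ ⊆ M → R ∪ (T₁ ∪ T₂) = M →
      v M ≤ pickVal v k true R T₁ + pickVal v k false R T₂ := by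
  induction k with
  | zero =>
    intro R T₁ T₂ hR h₁ h₂ hM
    rw [Finset.card_eq_zero.mp hR, Finset.empty_union] at hM
    simpa only [pickVal, hM] using hv T₁ T₂ h₁ h₂
  | succ k ih =>
    intro R T₁ T₂ hR h₁ h₂ hM
    have hne : R.Nonempty := Finset.card_pos.mp (by omega)
    simp only [pickVal, hne, if_true, dif_pos, Bool.false_eq_true, if_false]
    obtain ⟨e, he, heq⟩ := Finset.mem_image.mp (Finset.min'_mem
      (R.image fun e => pickVal v k true (R.erase e) T₂) (hne.image _))
    rw [← heq]
    have heM : e ∈ M := hM ▸ Finset.mem_union_left _ he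
    have hcover : R.erase e ∪ (T₂ ∪ insert e T₁) = M := by
      rw [← hM]
      ext x
      by_cases hx : x = e <;> simp [hx, he, or_comm]
    have hle := ih (R.erase e) T₂ (insert e T₁)
      (by rw [Finset.card_erase_of_mem he, hR, Nat.add_sub_cancel]) h₂
      (Finset.insert_subset heM h₁) hcover
    have hmax := Finset.le_max' (R.image fun e => pickVal v k false (R.erase e) (insert e T₁)) _
      (Finset.mem_image_of_mem _ he)
    linarith

theorem stmt7 {α : Type*} [DecidableEq α] (M : Finset α) (v : Finset α → ℝ)
    (hv : IsValuation M v) :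
    omegaP M v + omegaQ M v ≥ v M := by
  exact le_pickVal_true_add_pickVal_false hv.2.2 M.card M ∅ ∅ rfl (Finset.empty_subset M)
    (Finset.empty_subset M) (by simp)
end

section
/- Let M be a finite set of items, let v be a normalized, monotone, subadditive valuation on M, and let δ ≥ 0 be such that v({e}) ≤ δ for every item e ∈ M. Then ω(S_q, M, v) ≥ (v(M) − δ)/2. -/
open Finset

/-- `pickVal` with the fuel set to the number of remaining items. -/
noncomputable def gameVal {α : Type*} [DecidableEq α] (v : Finset α → ℝ) (b : Bool)
    (R T : Finset α) : ℝ :=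
  pickVal v R.card b R T

section GameVal

variable {α : Type*} [DecidableEq α] {v : Finset α → ℝ} {M R T : Finset α} {e : α}

lemma gameVal_empty (b : Bool) : gameVal v b ∅ T = v T := by
  simp [gameVal, pickVal]

lemma gameVal_true_of_nonempty (hR : R.Nonempty) :
    gameVal v true R T =
      (R.image fun e => gameVal v false (R.erase e) (insert e T)).max' (hR.image _) := by
  obtain ⟨k, hk⟩ := Nat.exists_eq_succ_of_ne_zero hR.card_ne_zero
  have himg : (R.image fun e => gameVal v false (R.erase e) (insert e T)) =
      R.image fun e => pickVal v k false (R.erase e) (insert e T) :=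
    image_congr fun e he => by simp [gameVal, card_erase_of_mem (mem_coe.1 he), hk]
  simp only [himg]
  rw [gameVal, hk, pickVal]
  simp [hR]

lemma gameVal_false_of_nonempty (hR : R.Nonempty) :
    gameVal v false R T =
      (R.image fun e => gameVal v true (R.erase e) T).min' (hR.image _) := by
  obtain ⟨k, hk⟩ := Nat.exists_eq_succ_of_ne_zero hR.card_ne_zero
  have himg : (R.image fun e => gameVal v true (R.erase e) T) =
      R.image fun e => pickVal v k true (R.erase e) T :=
    image_congr fun e he => by simp [gameVal, card_erase_of_mem (mem_coe.1 he), hk]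
  simp only [himg]
  rw [gameVal, hk, pickVal]
  simp [hR]

lemma le_gameVal_true (he : e ∈ R) :
    gameVal v false (R.erase e) (insert e T) ≤ gameVal v true R T := by
  rw [gameVal_true_of_nonempty ⟨e, he⟩]
  exact le_max' _ _ (mem_image_of_mem (fun e => gameVal v false (R.erase e) (insert e T)) he)

lemma gameVal_false_le (he : e ∈ R) :
    gameVal v false R T ≤ gameVal v true (R.erase e) T := by
  rw [gameVal_false_of_nonempty ⟨e, he⟩]
  exact min'_le _ _ (mem_image_of_mem (fun e => gameVal v true (R.erase e) T) he)

lemma exists_gameVal_true_eq (hR : R.Nonempty) :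
    ∃ e ∈ R, gameVal v true R T = gameVal v false (R.erase e) (insert e T) := by
  rw [gameVal_true_of_nonempty hR]
  obtain ⟨e, he, h⟩ := mem_image.1 (max'_mem _ (hR.image fun e =>
    gameVal v false (R.erase e) (insert e T)))
  exact ⟨e, he, h.symm⟩

lemma exists_gameVal_false_eq (hR : R.Nonempty) :
    ∃ e ∈ R, gameVal v false R T = gameVal v true (R.erase e) T := by
  rw [gameVal_false_of_nonempty hR]
  obtain ⟨e, he, h⟩ := mem_image.1 (min'_mem _ (hR.image fun e =>
    gameVal v true (R.erase e) T))
  exact ⟨e, he, h.symm⟩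

/-- Receiving an extra item for free, or receiving the move, does not hurt player `p`. -/
lemma gameVal_le_erase_insert_and_false_le_true
    (hmono : ∀ S T : Finset α, S ⊆ T → T ⊆ M → v S ≤ v T) (R : Finset α) :
    R ⊆ M → ∀ T ⊆ M,
      (∀ x ∈ R, ∀ b, gameVal v b R T ≤ gameVal v b (R.erase x) (insert x T)) ∧
        gameVal v false R T ≤ gameVal v true R T := by
  induction R using Finset.strongInduction with
  | H R ih =>
  intro hR T hT
  have hextra : ∀ x ∈ R, ∀ b, gameVal v b R T ≤ gameVal v b (R.erase x) (insert x T) := by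
    intro x hx b
    have hxT : insert x T ⊆ M := insert_subset (hR hx) hT
    have hxR : R.erase x ⊆ M := (erase_subset _ _).trans hR
    cases b with
    | true =>
      obtain ⟨z, hz, hzv⟩ := exists_gameVal_true_eq (v := v) (T := T) ⟨x, hx⟩
      rw [hzv]
      by_cases hzx : z = x
      · subst hzx
        exact (ih _ (erase_ssubset hx) hxR _ hxT).2
      · calc gameVal v false (R.erase z) (insert z T)
            ≤ gameVal v false ((R.erase z).erase x) (insert x (insert z T)) :=
              (ih _ (erase_ssubset hz) ((erase_subset _ _).trans hR) _
                (insert_subset (hR hz) hT)).1 x (mem_erase.2 ⟨Ne.symm hzx, hx⟩) false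
          _ = gameVal v false ((R.erase x).erase z) (insert z (insert x T)) := by
              rw [erase_right_comm, insert_comm]
          _ ≤ gameVal v true (R.erase x) (insert x T) :=
              le_gameVal_true (mem_erase.2 ⟨hzx, hz⟩)
    | false =>
      rcases (R.erase x).eq_empty_or_nonempty with h0 | hne
      · have h := gameVal_false_le (v := v) (T := T) hx
        rw [h0, gameVal_empty] at h ⊢
        exact h.trans (hmono _ _ (subset_insert _ _) hxT)
      · obtain ⟨y, hy, hyv⟩ := exists_gameVal_false_eq (v := v) (T := insert x T) hne
        obtain ⟨hyx, hyR⟩ := mem_erase.1 hy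
        rw [hyv, erase_right_comm]
        exact (gameVal_false_le hyR).trans
          ((ih _ (erase_ssubset hyR) ((erase_subset _ _).trans hR) _ hT).1 x
            (mem_erase.2 ⟨Ne.symm hyx, hx⟩) true)
  refine ⟨hextra, ?_⟩
  rcases R.eq_empty_or_nonempty with rfl | ⟨x, hx⟩
  · simp [gameVal_empty]
  · exact (hextra x hx false).trans (le_gameVal_true hx)

lemma gameVal_insert_le (hv : IsValuation M v) {δ : ℝ} (hδ : ∀ e ∈ M, v {e} ≤ δ) (he : e ∈ M)
    (R : Finset α) :
    R ⊆ M → ∀ b, ∀ T ⊆ M, gameVal v b R (insert e T) ≤ gameVal v b R T + δ := by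
  induction R using Finset.strongInduction with
  | H R ih =>
  intro hR b T hT
  rcases R.eq_empty_or_nonempty with rfl | hne
  · rw [gameVal_empty, gameVal_empty]
    have h := hv.2.2 {e} T (singleton_subset_iff.2 he) hT
    rw [← insert_eq] at h
    linarith [hδ e he]
  · cases b with
    | true =>
      obtain ⟨z, hz, hzv⟩ := exists_gameVal_true_eq (v := v) (T := insert e T) hne
      have h := ih _ (erase_ssubset hz) ((erase_subset _ _).trans hR) false (insert z T)
        (insert_subset (hR hz) hT)
      rw [hzv, insert_comm]
      linarith [le_gameVal_true (v := v) (T := T) hz]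
    | false =>
      obtain ⟨z, hz, hzv⟩ := exists_gameVal_false_eq (v := v) (T := T) hne
      have h := ih _ (erase_ssubset hz) ((erase_subset _ _).trans hR) true T hT
      rw [hzv]
      linarith [gameVal_false_le (v := v) (T := insert e T) hz]

/-- Receiving an available item `e` for free is worth at most `δ` to player `p`. -/
lemma gameVal_erase_insert_le (hv : IsValuation M v) {δ : ℝ} (hδ0 : 0 ≤ δ)
    (hδ : ∀ e ∈ M, v {e} ≤ δ) (R : Finset α) :
    R ⊆ M → ∀ b, ∀ T ⊆ M, ∀ e ∈ R,
      gameVal v b (R.erase e) (insert e T) ≤ gameVal v b R T + δ := by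
  induction R using Finset.strongInduction with
  | H R ih =>
  intro hR b T hT e he
  have heR : R.erase e ⊆ M := (erase_subset _ _).trans hR
  cases b with
  | true =>
    rcases (R.erase e).eq_empty_or_nonempty with h0 | hne
    · have h := le_gameVal_true (v := v) (T := T) he
      rw [h0, gameVal_empty] at h ⊢
      linarith
    · obtain ⟨z, hz, hzv⟩ := exists_gameVal_true_eq (v := v) (T := insert e T) hne
      obtain ⟨hze, hzR⟩ := mem_erase.1 hz
      have h := ih _ (erase_ssubset hzR) ((erase_subset _ _).trans hR) false (insert z T)
        (insert_subset (hR hzR) hT) e (mem_erase.2 ⟨Ne.symm hze, he⟩)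
      rw [hzv, erase_right_comm, insert_comm]
      linarith [le_gameVal_true (v := v) (T := T) hzR]
  | false =>
    obtain ⟨y, hy, hyv⟩ := exists_gameVal_false_eq (v := v) (T := T) ⟨e, he⟩
    rw [hyv]
    by_cases hye : y = e
    · subst hye
      linarith [gameVal_insert_le hv hδ (hR he) _ heR false T hT,
        (gameVal_le_erase_insert_and_false_le_true hv.2.1 _ heR T hT).2]
    · have h := ih _ (erase_ssubset hy) ((erase_subset _ _).trans hR) true T hT e
        (mem_erase.2 ⟨Ne.symm hye, he⟩)
      rw [erase_right_comm] at h
      linarith [gameVal_false_le (v := v) (T := insert e T) (mem_erase.2 ⟨hye, hy⟩)]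

/-- If the two bundles and the remaining items cover `M`, then the guarantees of the player to
move and of the other player add up to at least `v M`. -/
lemma le_gameVal_true_add_gameVal_false (hv : IsValuation M v) (R : Finset α) :
    ∀ T ⊆ M, ∀ T' ⊆ M, R ⊆ M → M ⊆ R ∪ (T ∪ T') →
      v M ≤ gameVal v true R T + gameVal v false R T' := by
  induction R using Finset.strongInduction with
  | H R ih =>
  intro T hT T' hT' hR hcover
  rcases R.eq_empty_or_nonempty with rfl | hne
  · rw [gameVal_empty, gameVal_empty]
    rw [empty_union] at hcover
    exact (hv.2.1 _ _ hcover (union_subset hT hT')).trans (hv.2.2 _ _ hT hT')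
  · obtain ⟨z, hz, hzv⟩ := exists_gameVal_false_eq (v := v) (T := T') hne
    have h := ih _ (erase_ssubset hz) T' hT' (insert z T) (insert_subset (hR hz) hT)
      ((erase_subset _ _).trans hR) (fun a ha => by
        have := hcover ha
        simp only [mem_union, mem_erase, mem_insert] at this ⊢
        tauto)
    rw [hzv]
    linarith [le_gameVal_true (v := v) (T := T) hz]

end GameVal

theorem stmt9 {α : Type*} [DecidableEq α] (M : Finset α) (v : Finset α → ℝ)
    (hv : IsValuation M v) (δ : ℝ) (hδ0 : 0 ≤ δ) (hδ : ∀ e ∈ M, v {e} ≤ δ) :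
    omegaQ M v ≥ (v M - δ) / 2 := by
  change (v M - δ) / 2 ≤ gameVal v false M ∅
  have hsum := le_gameVal_true_add_gameVal_false hv M ∅ (empty_subset _) ∅ (empty_subset _)
    Subset.rfl (by simp)
  have hdiff : gameVal v true M ∅ ≤ gameVal v false M ∅ + δ := by
    rcases M.eq_empty_or_nonempty with rfl | hne
    · simpa [gameVal_empty] using hδ0
    · obtain ⟨e, he, h⟩ := exists_gameVal_true_eq (v := v) (T := ∅) hne
      rw [h]
      exact gameVal_erase_insert_le hv hδ0 hδ M Subset.rfl false ∅ (empty_subset _) e he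
  linarith
end
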